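/- arXiv:1104.0450 — 2 statements merged into one kernel-verified Lean document; each statement's English description precedes it below -/
import Mathlib

section
/- Let C > 0 and b > 0. Let Ω ⊂ ℝ² be a normalized convex domain and f ∈ 𝒮(Ω,C) satisfy PDE (1.2) with parameter β = 0, and assume 1/ρ ≤ b on Ω. Then there exist positive constants α, N, m and a constant d₁ > 0 depending only on α, C and b, such that 𝒜 ≤ max{d₁, (4/α)·𝒟}. -/
open Real Filter Topology Matrix

noncomputable section

/-- The `i`-th partial derivative of `f`. -/
def pd {n : ℕ} (i : Fin n) (f : (Fin n → ℝ) → ℝ) : (Fin n → ℝ) → ℝ :=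
  fun x => fderiv ℝ f x (Pi.single i 1)

/-- The Hessian matrix `(∂²f/∂x_i∂x_j)` of `f` at `x`. -/
def hess {n : ℕ} (f : (Fin n → ℝ) → ℝ) (x : Fin n → ℝ) : Matrix (Fin n) (Fin n) ℝ :=
  Matrix.of fun i j => pd i (pd j f) x

/-- The gradient vector of `f` at `x`. -/
def gradv {n : ℕ} (f : (Fin n → ℝ) → ℝ) (x : Fin n → ℝ) : Fin n → ℝ :=
  fun i => pd i f x

/-- `ρ := (det (f_ij))^(-1/(n+2))`. -/
def rho {n : ℕ} (f : (Fin n → ℝ) → ℝ) (x : Fin n → ℝ) : ℝ :=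
  (hess f x).det ^ (-(1 : ℝ) / ((n : ℝ) + 2))

/-- The squared norm `‖grad h‖² = ∑ f^{ij} h_i h_j` with respect to the Calabi metric of `f`. -/
def gradSq {n : ℕ} (f h : (Fin n → ℝ) → ℝ) (x : Fin n → ℝ) : ℝ :=
  ∑ i, ∑ j, (hess f x)⁻¹ i j * pd i h x * pd j h x

/-- The Laplacian `Δh = (1/√det)(∑ ∂_i(√det · f^{ij} ∂_j h))` with respect to the
Calabi metric of `f`. -/
def calabiLap {n : ℕ} (f h : (Fin n → ℝ) → ℝ) (x : Fin n → ℝ) : ℝ :=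
  (Real.sqrt (hess f x).det)⁻¹ *
    ∑ i, ∑ j, pd i (fun y => Real.sqrt (hess f y).det * (hess f y)⁻¹ i j * pd j h y) x

/-- `Φ := ‖grad ρ‖²/ρ²`. -/
def Phi {n : ℕ} (f : (Fin n → ℝ) → ℝ) (x : Fin n → ℝ) : ℝ :=
  gradSq f (rho f) x / (rho f x) ^ 2

/-- PDE (1.2): `Δρ = -β ‖grad ρ‖²/ρ` on `Ω`. -/
def PDE2 {n : ℕ} (f : (Fin n → ℝ) → ℝ) (β : ℝ) (Ω : Set (Fin n → ℝ)) : Prop :=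
  ∀ x ∈ Ω, calabiLap f (rho f) x = -β * gradSq f (rho f) x / rho f x

/-- The cofactor matrix of a square matrix. -/
def cof {n : ℕ} (H : Matrix (Fin n) (Fin n) ℝ) : Matrix (Fin n) (Fin n) ℝ :=
  (Matrix.adjugate H)ᵀ

/-- PDE (1.1): `∑ F^{ij} w_ij = 0` with `w = (det (f_ij))^a` on `Ω`, where `(F^{ij})`
is the cofactor matrix of the Hessian of `f`. -/
def PDE1 {n : ℕ} (f : (Fin n → ℝ) → ℝ) (a : ℝ) (Ω : Set (Fin n → ℝ)) : Prop :=
  ∀ x ∈ Ω, ∑ i, ∑ j,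
    cof (hess f x) i j * pd i (pd j fun y => (hess f y).det ^ a) x = 0

/-- `f` is a quadratic polynomial on `ℝ²`. -/
def IsQuadratic (f : (Fin 2 → ℝ) → ℝ) : Prop :=
  ∃ (Q : Matrix (Fin 2) (Fin 2) ℝ) (b : Fin 2 → ℝ) (c : ℝ),
    ∀ x, f x = (∑ i, ∑ j, Q i j * x i * x j) + (∑ i, b i * x i) + c

/-- Euclidean open ball of radius `r` centered at `0` in `ℝ²`. -/
def ebal (r : ℝ) : Set (Fin 2 → ℝ) := {x | (x 0) ^ 2 + (x 1) ^ 2 < r ^ 2}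

/-- Euclidean norm on `ℝ²`. -/
def enorm2 (x : Fin 2 → ℝ) : ℝ := Real.sqrt ((x 0) ^ 2 + (x 1) ^ 2)

/-- A normalized convex domain: `B_{2^{-3/2}}(0) ⊆ Ω ⊆ B_1(0)`. -/
def NormalizedDomain (Ω : Set (Fin 2 → ℝ)) : Prop :=
  IsOpen Ω ∧ Convex ℝ Ω ∧ ebal ((2 : ℝ) ^ (-(3 : ℝ) / 2)) ⊆ Ω ∧ Ω ⊆ ebal 1

/-- The class `𝒮(Ω,C)`: smooth strictly convex functions on `Ω` with `inf f = 0` and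
`f = C` on `∂Ω`. -/
def SClass (Ω : Set (Fin 2 → ℝ)) (C : ℝ) (f : (Fin 2 → ℝ) → ℝ) : Prop :=
  ContDiffOn ℝ (⊤ : ℕ∞) f Ω ∧ (∀ x ∈ Ω, (hess f x).PosDef) ∧
    sInf (f '' Ω) = 0 ∧ ContinuousOn f (closure Ω) ∧ ∀ x ∈ frontier Ω, f x = C

/-- `u` is the Legendre transform function of `f` relative to `0`:
`u(∇f(x)) = ⟨x, ∇f(x)⟩ - f(x)`. -/
def LegendreOf (Ω : Set (Fin 2 → ℝ)) (f u : (Fin 2 → ℝ) → ℝ) : Prop :=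
  ∀ x ∈ Ω, u (gradv f x) = (∑ i, x i * gradv f x i) - f x

end

/-- `𝒜 = max_Ω exp{-m/(C-f)} Φ / ρ^α` (case `β = 0`, no `(d+u)`-weight). -/
noncomputable def Aval0 (Ω : Set (Fin 2 → ℝ)) (C m α : ℝ) (f : (Fin 2 → ℝ) → ℝ) : ℝ :=
  sSup ((fun x => Real.exp (-m / (C - f x)) * Phi f x / (rho f x) ^ α) '' Ω)

/-- `K = (N/𝒜) exp{-m/(C-f)} Φ / ρ^α`. -/
noncomputable def Kfun0 (Ω : Set (Fin 2 → ℝ)) (C m α N : ℝ) (f : (Fin 2 → ℝ) → ℝ)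
    (x : Fin 2 → ℝ) : ℝ :=
  N / Aval0 Ω C m α f * (Real.exp (-m / (C - f x)) * Phi f x / (rho f x) ^ α)

/-- `𝒟 = max_Ω exp{-m/(C-f)+K} g² ‖grad f‖² / ρ^α` with `g = m/(C-f)²`. -/
noncomputable def Dval0 (Ω : Set (Fin 2 → ℝ)) (C m α N : ℝ) (f : (Fin 2 → ℝ) → ℝ) : ℝ :=
  sSup ((fun x => Real.exp (-m / (C - f x) + Kfun0 Ω C m α N f x) *
    (m / (C - f x) ^ 2) ^ 2 * gradSq f f x / (rho f x) ^ α) '' Ω)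


/-- scalar inequality -/
lemma alg_rest (Φ w d g σ : ℝ) (hΦ : 0 ≤ Φ) (hw : 0 ≤ w) (hd : d ^ 2 ≤ Φ * w) (hg : 0 ≤ g)
    (hσ : 0 ≤ σ) (hσ' : σ ≤ 1 / 100000) :
    (1 / 2000) * (Φ + w) ^ 2 - 4 * g * (Φ + w) ≤
    -(Φ * (w + 44 * d + 484 * Φ) - 2 * (1/20) * (w * d + 22 * (2 * d ^ 2 - Φ * w)) + (1/20) ^ 2 * w ^ 2)
     + 5 * Φ ^ 2 - (1/20) * w * Φ - (1/40) * w * ((1 - 4 * σ) ^ 2 * w + 36 * (1 - 4 * σ) * d + 324 * Φ)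
     + (1/20) * (3 * Φ * w + 8 * σ * w * d - 2 * w * (d + 20 * Φ))
     + (1/20) * ((2 * g + 2 * d) ^ 2 - 4 * d ^ 2 + 2 * (2 * g + 2 * d) * d + 8 * σ * (2 * g + 2 * d) * w
        + 8 * σ * w * (g + d) + 20 * σ ^ 2 * w ^ 2)
     + (Φ + (1/20) * w) * (-(2 * g + 2 * d) - 2 * σ * w + 20 * Φ)
     + (Φ + (1/20) * w) * (w + 40 * d + 400 * Φ) + 4 * Φ * (d + 20 * Φ)
     - 2 * (1/20) * (2 * g + 2 * d) * (w + 20 * d) - 8 * (1/20) * σ * w * (w + 20 * d) := by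
  have hd1 : 2 * |d| ≤ Φ + w := by
    have : d ^ 2 ≤ ((Φ + w) / 2) ^ 2 := by nlinarith [sq_nonneg (Φ - w)]
    have := sq_le_sq.mp this
    rw [abs_of_nonneg (by positivity : 0 ≤ (Φ + w) / 2)] at this
    linarith
  obtain ⟨hd2, hd3⟩ := abs_le.mp (by linarith : |d| ≤ (Φ + w) / 2)
  have hpure : (1 / 1000) * (Φ + w) ^ 2 ≤ 21 * Φ ^ 2 - 2 * Φ * d +
      (1/20) * ((9/20) * w ^ 2 + 16 * w * d + 176 * w * Φ + 12 * d ^ 2) := by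
    have h1 : 0 ≤ w * ((4/10) * w + 16 * d + 160 * Φ) := by
      apply mul_nonneg hw
      by_contra hneg
      push Not at hneg
      nlinarith [sq_nonneg (w - 400 * Φ), sq_nonneg (w + 40 * d/2 ), mul_nonneg hΦ hw]
    have h2 : 2 * Φ * d ≤ 4 * Φ ^ 2 + Φ * w / 4 := by
      have : 2 * d ≤ 4 * Φ + w / 4 := by
        by_contra hneg
        push Not at hneg
        nlinarith [sq_nonneg (4 * Φ - w / 4), mul_nonneg hΦ hw]
      nlinarith
    nlinarith [mul_nonneg hΦ hw, sq_nonneg d, sq_nonneg Φ, sq_nonneg w]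
  have hgd : -(4 * g * (Φ + w)) ≤ g * (-2 * Φ - (6/20) * w - (68/20) * d + (24/20) * σ * w) := by
    have : -(4 * (Φ + w)) ≤ (-2 * Φ - (6/20) * w - (68/20) * d + (24/20) * σ * w) := by
      nlinarith [mul_nonneg hσ hw]
    nlinarith [mul_le_mul_of_nonneg_left this hg]
  have hs : -(w ^ 2 + Φ * w) / 2000 ≤ σ * (
     - (1/40) * w * ((-8 + 16 * σ) * w - 144 * d)
     + (1/20) * (8 * w * d)
     + (1/20) * (16 * d * w + 8 * w * d + 20 * σ * w ^ 2)
     + (Φ + (1/20) * w) * (- 2 * w)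
      - 8 * (1/20) * w * (w + 20 * d)) := by
    have e : σ * (
     - (1/40) * w * ((-8 + 16 * σ) * w - 144 * d)
     + (1/20) * (8 * w * d)
     + (1/20) * (16 * d * w + 8 * w * d + 20 * σ * w ^ 2)
     + (Φ + (1/20) * w) * (- 2 * w)
      - 8 * (1/20) * w * (w + 20 * d)) = σ * w * ((-3/10 + 6/10 * σ) * w - 2 * Φ - (28/10) * d) := by ring
    rw [e]
    have hsw := mul_nonneg hσ hw
    have hb : -(4 * (w + Φ)) ≤ (-3/10 + 6/10 * σ) * w - 2 * Φ - (28/10) * d := by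
      nlinarith
    have hb2 := mul_le_mul_of_nonneg_left hb hsw
    have hb3 : σ * w * (4 * (w + Φ)) ≤ (1 / 100000) * (w * (4 * (w + Φ))) := by
      have := mul_le_mul_of_nonneg_right hσ' (by positivity : 0 ≤ w * (4 * (w + Φ)))
      linarith
    nlinarith [mul_nonneg hΦ hw, sq_nonneg w]
  nlinarith [sq_nonneg g]

/-- the tensor inequality at a critical point, in an orthonormal frame -/
lemma alg_main (l1 l2 x1 x2 s r p q g σ : ℝ) (hg : 0 ≤ g)
    (hσ : 0 ≤ σ) (hσ' : σ ≤ 1 / 100000) (Φ w d τ M hp hq V1 V2 D1 D2: ℝ)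
    (hΦ : Φ = l1 ^ 2 + l2 ^ 2) (hw : w = x1 ^ 2 + x2 ^ 2) (hd : d = l1 * x1 + l2 * x2)
    (hτ : τ = 2 * g + 2 * d) (hM : M = Φ + (1/20) * w)
    (hhp : hp = s * x1 + r * x2 + (1/2) * (l1 * x1 - l2 * x2))
    (hhq : hq = r * x1 - s * x2 + (1/2) * (l1 * x2 + l2 * x1))
    (hV1 : V1 = x1 + 20 * l1) (hV2 : V2 = x2 + 20 * l2)
    (hD1 : D1 = 2 * (p * l1 + q * l2) - 2 * Φ * l1
      + (1/20) * (2 * (hp * x1 + hq * x2 + τ / 2 * x1) + 4 * σ * w * x1))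
    (hD2 : D2 = 2 * (q * l1 - p * l2) - 2 * Φ * l2
      + (1/20) * (2 * (hq * x1 - hp * x2 + τ / 2 * x2) + 4 * σ * w * x2)) :
    (1 / 2000) * (Φ + w) ^ 2 - 4 * g * (Φ + w) ≤
    4 * (p ^ 2 + q ^ 2) - 8 * (p * (l1 ^ 2 - l2 ^ 2) + 2 * q * l1 * l2) + 6 * Φ ^ 2
      + (4 * (s ^ 2 + r ^ 2) - Φ) * Φ
      + (1/20) * (4 * (hp ^ 2 + hq ^ 2) + τ ^ 2 + 4 * (p * (x1 ^ 2 - x2 ^ 2) + 2 * q * x1 * x2)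
         - 4 * d ^ 2 + 4 * (hp * (l1 * x1 - l2 * x2) + hq * (l1 * x2 + l2 * x1) + τ / 2 * d)
         + (4 * (s ^ 2 + r ^ 2) - Φ) * w
         + 16 * σ * (hp * (x1 ^ 2 - x2 ^ 2) + 2 * hq * x1 * x2 + τ / 2 * w)
         + 8 * σ * w * (g + d) + 20 * σ ^ 2 * w ^ 2)
      + M * (-τ - 2 * σ * w + 20 * Φ) + M * (V1 ^ 2 + V2 ^ 2) - 2 * (V1 * D1 + V2 * D2) := by
  have h1 := alg_rest Φ w d g σ (by rw [hΦ]; positivity) (by rw [hw]; positivity)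
    (by rw [hΦ, hw, hd]; nlinarith [sq_nonneg (l1 * x2 - l2 * x1)]) hg hσ hσ'
  refine h1.trans ?_
  have h2 : 0 ≤ (2 * p - (2 * (l1 ^ 2 - l2 ^ 2) + (l1 * V1 - l2 * V2) - (1/20) * (x1 ^ 2 - x2 ^ 2))) ^ 2
    + (2 * q - (4 * l1 * l2 + (l1 * V2 + l2 * V1) - (1/20) * (2 * x1 * x2))) ^ 2
    + (1/40) * ((4 * (s * x1 + r * x2) + (x1 * (2 * l1 + 4 * σ * x1 - V1) - x2 * (2 * l2 + 4 * σ * x2 - V2))) ^ 2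
      + (4 * (r * x1 - s * x2) + (x1 * (2 * l2 + 4 * σ * x2 - V2) + x2 * (2 * l1 + 4 * σ * x1 - V1))) ^ 2)
    + 4 * (s ^ 2 + r ^ 2) * (l1 ^ 2 + l2 ^ 2) := by positivity
  rw [← sub_nonneg]
  refine h2.trans (le_of_eq ?_)
  subst hD1 hD2 hV1 hV2 hhp hhq hM hτ hd hw hΦ
  ring


/-- The polarized form `c pP - b(pQ+qP) + a qQ`. -/
def BF (c b a p q P Q : ℝ) : ℝ := c * p * P - b * (p * Q + q * P) + a * q * Q

/-- First directional derivative of the form. -/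
def BF1 (c b a p q c' b' a' p' q' : ℝ) : ℝ := BF c' b' a' p q p q + 2 * BF c b a p' q' p q

/-- Second directional derivative of the form. -/
def BF2 (c b a p q c' b' a' p' q' c'' b'' a'' p'' q'' : ℝ) : ℝ :=
  BF c'' b'' a'' p q p q + 4 * BF c' b' a' p' q' p q + 2 * BF c b a p'' q'' p q
    + 2 * BF c b a p' q' p' q'

lemma scal_fin (X g : ℝ) (hX : 0 ≤ X) (hg : 0 ≤ g) (h : (1/2000)*X^2 - 4*g*X ≤ 0) : X ≤ 8000 * g := by
  by_contra hcon
  push Not at hcon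
  have h1 : 0 < X := by linarith
  nlinarith [mul_pos h1 (sub_pos.mpr hcon)]

set_option maxHeartbeats 2000000 in
lemma jets (A B C D f1111 f1112 f1122 f1222 f2222 l1 l2 l11 l12 l22 l111 l112 l122 l222
    f1 f2 g σ : ℝ) (hg : 0 ≤ g) (hσ : 0 ≤ σ) (hσ' : σ ≤ 1 / 100000)
    (hl1 : -4 * l1 = A + C) (hl2 : -4 * l2 = B + D)
    (h11 : -4 * l11 + 16 * l1 * l1 = f1111 + f1122 + 2 * A * C - 2 * B * B)
    (h12 : -4 * l12 + 16 * l1 * l2 = f1112 + f1222 + A * D + B * C - 2 * B * C)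
    (h22 : -4 * l22 + 16 * l2 * l2 = f1122 + f2222 + 2 * B * D - 2 * C * C)
    (hP : l11 + 3 * l1 ^ 2 + l22 + 3 * l2 ^ 2 = 0)
    (hP1 : C * (l11 + 3 * l1 ^ 2) - 2 * B * (l12 + 3 * l1 * l2) + A * (l22 + 3 * l2 ^ 2)
      + l111 + 6 * l1 * l11 + l122 + 6 * l2 * l12 = 0)
    (hP2 : D * (l11 + 3 * l1 ^ 2) - 2 * C * (l12 + 3 * l1 * l2) + B * (l22 + 3 * l2 ^ 2)
      + l112 + 6 * l1 * l12 + l222 + 6 * l2 * l22 = 0)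
    (N N1 N2 E1 E2 N1' N2' E1' E2' : ℝ)
    (hN : N = BF 1 0 1 l1 l2 l1 l2 + (1/20) * g ^ 2 * BF 1 0 1 f1 f2 f1 f2)
    (hE1 : E1 = - g * f1 - 16 * l1) (hE1' : E1' = - g * f2 - 16 * l2)
    (hE2 : E2 = -(2 * σ * g ^ 2 * f1 ^ 2 + g) - 16 * l11)
    (hE2' : E2' = -(2 * σ * g ^ 2 * f2 ^ 2 + g) - 16 * l22)
    (hN1 : N1 = BF1 1 0 1 l1 l2 C B A l11 l12 + (1/20) * g ^ 2 *
      (4 * σ * g * f1 * BF 1 0 1 f1 f2 f1 f2 + BF1 1 0 1 f1 f2 C B A 1 0))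
    (hN1' : N1' = BF1 1 0 1 l1 l2 D C B l12 l22 + (1/20) * g ^ 2 *
      (4 * σ * g * f2 * BF 1 0 1 f1 f2 f1 f2 + BF1 1 0 1 f1 f2 D C B 0 1))
    (hN2 : N2 = BF2 1 0 1 l1 l2 C B A l11 l12 f1122 f1112 f1111 l111 l112 + (1/20) * g ^ 2 *
      ((20 * σ ^ 2 * g ^ 2 * f1 ^ 2 + 4 * σ * g) * BF 1 0 1 f1 f2 f1 f2
        + 8 * σ * g * f1 * BF1 1 0 1 f1 f2 C B A 1 0
        + BF2 1 0 1 f1 f2 C B A 1 0 f1122 f1112 f1111 A B))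
    (hN2' : N2' = BF2 1 0 1 l1 l2 D C B l12 l22 f2222 f1222 f1122 l122 l222 + (1/20) * g ^ 2 *
      ((20 * σ ^ 2 * g ^ 2 * f2 ^ 2 + 4 * σ * g) * BF 1 0 1 f1 f2 f1 f2
        + 8 * σ * g * f2 * BF1 1 0 1 f1 f2 D C B 0 1
        + BF2 1 0 1 f1 f2 D C B 0 1 f2222 f1222 f1122 C D))
    (c1 : N1 + N * E1 = 0) (c2 : N1' + N * E1' = 0)
    (d1 : N2 + 2 * N1 * E1 + N * (E2 + E1 ^ 2) ≤ 0)
    (d2 : N2' + 2 * N1' * E1' + N * (E2' + E1' ^ 2) ≤ 0) :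
    N ≤ 8000 * g := by
  obtain ⟨s, hs⟩ : ∃ s, s = (C + l1) / 2 := ⟨_, rfl⟩
  obtain ⟨r, hr⟩ : ∃ r, r = (D + 3 * l2) / 2 := ⟨_, rfl⟩
  obtain rfl : C = 2 * s - l1 := by linarith
  obtain rfl : D = 2 * r - 3 * l2 := by linarith
  obtain rfl : A = -2 * s - 3 * l1 := by linarith
  obtain rfl : B = -2 * r - l2 := by linarith
  obtain ⟨q, hq⟩ : ∃ q, q = l12 + l1 * l2 + ((r + l2 / 2) * l1 + (-s + l1 / 2) * l2) := ⟨_, rfl⟩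
  obtain ⟨p, hp⟩ : ∃ p, p = ((l11 + (s + 3 / 2 * l1) * l1 + (r + l2 / 2) * l2)
    - (l22 + (-s + l1 / 2) * l1 + (-r + 3 / 2 * l2) * l2)) / 2 + (l1 ^ 2 - l2 ^ 2) / 2 := ⟨_, rfl⟩
  have e11 : l11 + l22 = -3 * l1 ^ 2 - 3 * l2 ^ 2 := by linarith
  have e11' : l11 - l22 = 2 * p - (l1 ^ 2 - l2 ^ 2) - ((s + 3 / 2 * l1) * l1 + (r + l2 / 2) * l2)
     + ((-s + l1 / 2) * l1 + (-r + 3 / 2 * l2) * l2) := by linarith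
  obtain rfl : l12 = q - l1 * l2 - ((r + l2 / 2) * l1 + (-s + l1 / 2) * l2) := by linarith
  obtain rfl : l11 = ((-3 * l1 ^ 2 - 3 * l2 ^ 2) + (2 * p - (l1 ^ 2 - l2 ^ 2)
    - ((s + 3 / 2 * l1) * l1 + (r + l2 / 2) * l2)
     + ((-s + l1 / 2) * l1 + (-r + 3 / 2 * l2) * l2))) / 2 := by linarith
  obtain rfl : l22 = ((-3 * l1 ^ 2 - 3 * l2 ^ 2) - (2 * p - (l1 ^ 2 - l2 ^ 2)
    - ((s + 3 / 2 * l1) * l1 + (r + l2 / 2) * l2)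
     + ((-s + l1 / 2) * l1 + (-r + 3 / 2 * l2) * l2))) / 2 := by linarith
  have main := alg_main l1 l2 (g * f1) (g * f2) s r p q g σ hg hσ hσ' _ _ _ _ _ _ _ _ _ _ _
    rfl rfl rfl rfl rfl rfl rfl rfl rfl rfl rfl
  have hI : (1/2000)*(l1^2+l2^2+((g*f1)^2+(g*f2)^2))^2 - 4*g*(l1^2+l2^2+((g*f1)^2+(g*f2)^2)) ≤
      (N2 + 2 * N1 * E1 + N * (E2 + E1 ^ 2)) + (N2' + 2 * N1' * E1' + N * (E2' + E1' ^ 2))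
      + 2 * l1 * (N1 + N * E1) + 2 * l2 * (N1' + N * E1') := by
    refine main.trans (le_of_eq ?_)
    clear main d1 d2 c1 c2
    subst hN2 hN2' hN1 hN1' hE1 hE1' hE2 hE2' hN
    simp only [BF2, BF1, BF]
    linear_combination (-2*l1)*hP1 + (-2*l2)*hP2 + (l1^2+(1/20)*g^2*f1^2)*h22 -
      2*(l1*l2+(1/20)*g^2*f1*f2)*h12 + (l2^2+(1/20)*g^2*f2^2)*h11
  rw [c1, c2] at hI
  have hpos : 0 ≤ l1 ^ 2 + l2 ^ 2 + ((g * f1) ^ 2 + (g * f2) ^ 2) := by positivity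
  have hfin : l1 ^ 2 + l2 ^ 2 + ((g * f1) ^ 2 + (g * f2) ^ 2) ≤ 8000 * g := by
    refine scal_fin _ g hpos hg (hI.trans ?_)
    linarith only [d1, d2]
  refine le_trans ?_ hfin
  rw [hN]; simp only [BF]
  linarith only [sq_nonneg (g * f1), sq_nonneg (g * f2)]


lemma line_test (N E N' E' : ℝ → ℝ) (N'' E'' : ℝ)
    (hN : ∀ᶠ t in 𝓝 (0:ℝ), HasDerivAt N (N' t) t) (hE : ∀ᶠ t in 𝓝 (0:ℝ), HasDerivAt E (E' t) t)
    (hN' : HasDerivAt N' N'' 0) (hE' : HasDerivAt E' E'' 0)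
    (hmax : IsLocalMax (fun t => Real.exp (E t) * N t) 0) :
    N' 0 + N 0 * E' 0 = 0 ∧ N'' + 2 * N' 0 * E' 0 + N 0 * (E'' + E' 0 ^ 2) ≤ 0 := by
  have hd : ∀ᶠ t in 𝓝 (0:ℝ), HasDerivAt (fun t => Real.exp (E t) * N t)
      (Real.exp (E t) * (N' t + N t * E' t)) t := by
    filter_upwards [hN, hE] with t h1 h2
    refine (h2.exp.mul h1).congr_deriv ?_
    ring
  have h0 : Real.exp (E 0) * (N' 0 + N 0 * E' 0) = 0 := hmax.hasDerivAt_eq_zero hd.self_of_nhds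
  have hc1 : N' 0 + N 0 * E' 0 = 0 := (mul_eq_zero.mp h0).resolve_left (Real.exp_ne_zero _)
  refine ⟨hc1, ?_⟩
  by_contra hcon
  push Not at hcon
  have hdd : HasDerivAt (fun t => Real.exp (E t) * (N' t + N t * E' t))
      (Real.exp (E 0) * (N'' + 2 * N' 0 * E' 0 + N 0 * (E'' + E' 0 ^ 2))) 0 := by
    refine (hE.self_of_nhds.exp.mul (hN'.add (hN.self_of_nhds.mul hE'))).congr_deriv ?_
    simp only [Pi.add_apply, Pi.mul_apply]
    ring
  have hderiv : deriv (fun t => Real.exp (E t) * N t) =ᶠ[𝓝 0]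
      fun t => Real.exp (E t) * (N' t + N t * E' t) := by
    filter_upwards [hd] with t ht using ht.deriv
  have hpos : 0 < Real.exp (E 0) * (N'' + 2 * N' 0 * E' 0 + N 0 * (E'' + E' 0 ^ 2)) :=
    mul_pos (Real.exp_pos _) hcon
  have hmin := isLocalMin_of_deriv_deriv_pos (f := fun t => Real.exp (E t) * N t) (x₀ := 0)
    (by rw [hderiv.deriv_eq, hdd.deriv]; exact hpos) (by rw [hd.self_of_nhds.deriv, h0])
    hd.self_of_nhds.continuousAt
  have hconst : (fun t => Real.exp (E t) * N t) =ᶠ[𝓝 0] fun _ => Real.exp (E 0) * N 0 := by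
    filter_upwards [hmin, hmax] with t h1 h2 using le_antisymm h2 h1
  have hz : deriv (fun t => Real.exp (E t) * N t) =ᶠ[𝓝 0] fun _ => 0 := by
    have := hconst.deriv
    refine this.trans ?_
    simp
  have h2 := (hderiv.symm.trans hz).deriv_eq
  rw [hdd.deriv] at h2
  rw [deriv_const] at h2
  exact hpos.ne' h2

lemma BF_deriv (c b a p q P Q c' b' a' p' q' P' Q' : ℝ → ℝ) (t : ℝ)
    (hc : HasDerivAt c (c' t) t) (hb : HasDerivAt b (b' t) t) (ha : HasDerivAt a (a' t) t)
    (hp : HasDerivAt p (p' t) t) (hq : HasDerivAt q (q' t) t)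
    (hP : HasDerivAt P (P' t) t) (hQ : HasDerivAt Q (Q' t) t) :
    HasDerivAt (fun t => BF (c t) (b t) (a t) (p t) (q t) (P t) (Q t))
      (BF (c' t) (b' t) (a' t) (p t) (q t) (P t) (Q t)
        + BF (c t) (b t) (a t) (p' t) (q' t) (P t) (Q t)
        + BF (c t) (b t) (a t) (p t) (q t) (P' t) (Q' t)) t := by
  have h := (((hc.mul hp).mul hP).sub (hb.mul ((hp.mul hQ).add (hq.mul hP)))).add ((ha.mul hq).mul hQ)
  refine (h.congr_deriv ?_)
  simp only [BF, Pi.add_apply, Pi.mul_apply]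
  ring

lemma BF1_deriv (c b a p q c' b' a' p' q' c'' b'' a'' p'' q'' : ℝ → ℝ) (t : ℝ)
    (hc : HasDerivAt c (c' t) t) (hb : HasDerivAt b (b' t) t) (ha : HasDerivAt a (a' t) t)
    (hp : HasDerivAt p (p' t) t) (hq : HasDerivAt q (q' t) t)
    (hc' : HasDerivAt c' (c'' t) t) (hb' : HasDerivAt b' (b'' t) t) (ha' : HasDerivAt a' (a'' t) t)
    (hp' : HasDerivAt p' (p'' t) t) (hq' : HasDerivAt q' (q'' t) t) :
    HasDerivAt (fun t => BF1 (c t) (b t) (a t) (p t) (q t) (c' t) (b' t) (a' t) (p' t) (q' t))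
      (BF2 (c t) (b t) (a t) (p t) (q t) (c' t) (b' t) (a' t) (p' t) (q' t)
        (c'' t) (b'' t) (a'' t) (p'' t) (q'' t)) t := by
  have h := (BF_deriv c' b' a' p q p q c'' b'' a'' p' q' p' q' t hc' hb' ha' hp hq hp hq).add
    ((BF_deriv c b a p' q' p q c' b' a' p'' q'' p' q' t hc hb ha hp' hq' hp hq).const_mul 2)
  refine h.congr_deriv ?_
  simp only [BF2, BF]
  ring

lemma BF0_deriv (c b a p q c' b' a' p' q' : ℝ → ℝ) (t : ℝ)
    (hc : HasDerivAt c (c' t) t) (hb : HasDerivAt b (b' t) t) (ha : HasDerivAt a (a' t) t)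
    (hp : HasDerivAt p (p' t) t) (hq : HasDerivAt q (q' t) t) :
    HasDerivAt (fun t => BF (c t) (b t) (a t) (p t) (q t) (p t) (q t))
      (BF1 (c t) (b t) (a t) (p t) (q t) (c' t) (b' t) (a' t) (p' t) (q' t)) t := by
  have h := BF_deriv c b a p q p q c' b' a' p' q' p' q' t hc hb ha hp hq hp hq
  refine h.congr_deriv ?_
  simp only [BF1, BF]
  ring

lemma inv_pow_deriv (F F' : ℝ → ℝ) (k t : ℝ) (n : ℕ) (hF : HasDerivAt F (F' t) t) (hy : k - F t ≠ 0) :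
    HasDerivAt (fun t => (k - F t)⁻¹ ^ n) (n * (k - F t)⁻¹ ^ (n + 1) * F' t) t := by
  have h := ((hF.const_sub k).inv hy).pow n
  refine h.congr_deriv ?_
  simp only [Pi.inv_apply]
  rcases n with _ | n
  · simp
  · simp only [Nat.add_sub_cancel]
    have : - -F' t / (k - F t) ^ 2 = F' t * (k - F t)⁻¹ ^ 2 := by
      rw [inv_pow, div_eq_mul_inv, neg_neg]
    rw [this]; ring

/-- second order conditions along a line -/
lemma line_jets (c b a p q r s l F c' b' a' p' q' r' s' l' F' c'' b'' a'' p'' q'' r'' s'' l'' F'' : ℝ → ℝ)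
    (m μ k : ℝ) (hy : k - F 0 ≠ 0)
    (hc : ∀ᶠ t in 𝓝 (0:ℝ), HasDerivAt c (c' t) t) (hb : ∀ᶠ t in 𝓝 (0:ℝ), HasDerivAt b (b' t) t)
    (ha : ∀ᶠ t in 𝓝 (0:ℝ), HasDerivAt a (a' t) t) (hp : ∀ᶠ t in 𝓝 (0:ℝ), HasDerivAt p (p' t) t)
    (hq : ∀ᶠ t in 𝓝 (0:ℝ), HasDerivAt q (q' t) t) (hr : ∀ᶠ t in 𝓝 (0:ℝ), HasDerivAt r (r' t) t)
    (hs : ∀ᶠ t in 𝓝 (0:ℝ), HasDerivAt s (s' t) t) (hl : ∀ᶠ t in 𝓝 (0:ℝ), HasDerivAt l (l' t) t)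
    (hF : ∀ᶠ t in 𝓝 (0:ℝ), HasDerivAt F (F' t) t)
    (hc' : HasDerivAt c' (c'' 0) 0) (hb' : HasDerivAt b' (b'' 0) 0) (ha' : HasDerivAt a' (a'' 0) 0)
    (hp' : HasDerivAt p' (p'' 0) 0) (hq' : HasDerivAt q' (q'' 0) 0) (hr' : HasDerivAt r' (r'' 0) 0)
    (hs' : HasDerivAt s' (s'' 0) 0) (hl' : HasDerivAt l' (l'' 0) 0) (hF' : HasDerivAt F' (F'' 0) 0)
    (hmax : IsLocalMax (fun t => Real.exp (-m * (k - F t)⁻¹ - 16 * l t) *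
      (BF (c t) (b t) (a t) (p t) (q t) (p t) (q t)
        + μ * ((k - F t)⁻¹ ^ 4 * BF (c t) (b t) (a t) (r t) (s t) (r t) (s t)))) 0) :
    ∃ N N1 N2 E1 E2 z : ℝ, z = (k - F 0)⁻¹ ∧
      N = BF (c 0) (b 0) (a 0) (p 0) (q 0) (p 0) (q 0)
        + μ * (z ^ 4 * BF (c 0) (b 0) (a 0) (r 0) (s 0) (r 0) (s 0)) ∧
      E1 = -m * (z ^ 2 * F' 0) - 16 * l' 0 ∧
      E2 = -m * (2 * z ^ 3 * F' 0 * F' 0 + z ^ 2 * F'' 0) - 16 * l'' 0 ∧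
      N1 = BF1 (c 0) (b 0) (a 0) (p 0) (q 0) (c' 0) (b' 0) (a' 0) (p' 0) (q' 0)
        + μ * (4 * z ^ 5 * F' 0 * BF (c 0) (b 0) (a 0) (r 0) (s 0) (r 0) (s 0)
          + z ^ 4 * BF1 (c 0) (b 0) (a 0) (r 0) (s 0) (c' 0) (b' 0) (a' 0) (r' 0) (s' 0)) ∧
      N2 = BF2 (c 0) (b 0) (a 0) (p 0) (q 0) (c' 0) (b' 0) (a' 0) (p' 0) (q' 0)
            (c'' 0) (b'' 0) (a'' 0) (p'' 0) (q'' 0)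
        + μ * ((20 * z ^ 6 * F' 0 ^ 2 + 4 * z ^ 5 * F'' 0) * BF (c 0) (b 0) (a 0) (r 0) (s 0) (r 0) (s 0)
          + 8 * z ^ 5 * F' 0 * BF1 (c 0) (b 0) (a 0) (r 0) (s 0) (c' 0) (b' 0) (a' 0) (r' 0) (s' 0)
          + z ^ 4 * BF2 (c 0) (b 0) (a 0) (r 0) (s 0) (c' 0) (b' 0) (a' 0) (r' 0) (s' 0)
            (c'' 0) (b'' 0) (a'' 0) (r'' 0) (s'' 0)) ∧
      N1 + N * E1 = 0 ∧ N2 + 2 * N1 * E1 + N * (E2 + E1 ^ 2) ≤ 0 := by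
  have hyt : ∀ᶠ t in 𝓝 (0:ℝ), k - F t ≠ 0 := by
    have : ContinuousAt (fun t => k - F t) 0 := continuousAt_const.sub hF.self_of_nhds.continuousAt
    exact this.eventually_ne hy
  have hNd : ∀ᶠ t in 𝓝 (0:ℝ), HasDerivAt (fun t => BF (c t) (b t) (a t) (p t) (q t) (p t) (q t)
        + μ * ((k - F t)⁻¹ ^ 4 * BF (c t) (b t) (a t) (r t) (s t) (r t) (s t)))
      (BF1 (c t) (b t) (a t) (p t) (q t) (c' t) (b' t) (a' t) (p' t) (q' t)
        + μ * (4 * (k - F t)⁻¹ ^ 5 * F' t * BF (c t) (b t) (a t) (r t) (s t) (r t) (s t)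
          + (k - F t)⁻¹ ^ 4 * BF1 (c t) (b t) (a t) (r t) (s t) (c' t) (b' t) (a' t) (r' t) (s' t))) t := by
    filter_upwards [hc, hb, ha, hp, hq, hr, hs, hF, hyt] with t hc hb ha hp hq hr hs hF hy
    have h1 := BF0_deriv c b a p q c' b' a' p' q' t hc hb ha hp hq
    have h2 := BF0_deriv c b a r s c' b' a' r' s' t hc hb ha hr hs
    have h3 := inv_pow_deriv F F' k t 4 hF hy
    have h := h1.add ((h3.mul h2).const_mul μ)
    refine h.congr_deriv ?_
    norm_num
  have hEd : ∀ᶠ t in 𝓝 (0:ℝ), HasDerivAt (fun t => -m * (k - F t)⁻¹ - 16 * l t)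
      (-m * ((k - F t)⁻¹ ^ 2 * F' t) - 16 * l' t) t := by
    filter_upwards [hl, hF, hyt] with t hl hF hy
    have h3 := inv_pow_deriv F F' k t 1 hF hy
    have h := (h3.const_mul (-m)).sub (hl.const_mul 16)
    simp only [pow_one] at h
    refine h.congr_deriv ?_
    norm_num
  have hz := fun n => inv_pow_deriv F F' k 0 n hF.self_of_nhds hy
  have key := line_test _ _ _ _ 
    (BF2 (c 0) (b 0) (a 0) (p 0) (q 0) (c' 0) (b' 0) (a' 0) (p' 0) (q' 0)
            (c'' 0) (b'' 0) (a'' 0) (p'' 0) (q'' 0)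
        + μ * ((20 * (k - F 0)⁻¹ ^ 6 * F' 0 ^ 2 + 4 * (k - F 0)⁻¹ ^ 5 * F'' 0) * BF (c 0) (b 0) (a 0) (r 0) (s 0) (r 0) (s 0)
          + 8 * (k - F 0)⁻¹ ^ 5 * F' 0 * BF1 (c 0) (b 0) (a 0) (r 0) (s 0) (c' 0) (b' 0) (a' 0) (r' 0) (s' 0)
          + (k - F 0)⁻¹ ^ 4 * BF2 (c 0) (b 0) (a 0) (r 0) (s 0) (c' 0) (b' 0) (a' 0) (r' 0) (s' 0)
            (c'' 0) (b'' 0) (a'' 0) (r'' 0) (s'' 0)))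
    (-m * (2 * (k - F 0)⁻¹ ^ 3 * F' 0 * F' 0 + (k - F 0)⁻¹ ^ 2 * F'' 0) - 16 * l'' 0)
    hNd hEd ?_ ?_ hmax
  · exact ⟨_, _, _, _, _, _, rfl, rfl, rfl, rfl, rfl, rfl, key.1, key.2⟩
  · have hc := hc.self_of_nhds
    have hb := hb.self_of_nhds
    have ha := ha.self_of_nhds
    have h1 := BF1_deriv c b a p q c' b' a' p' q' c'' b'' a'' p'' q'' 0 hc hb ha hp.self_of_nhds
      hq.self_of_nhds hc' hb' ha' hp' hq'
    have h2 := BF1_deriv c b a r s c' b' a' r' s' c'' b'' a'' r'' s'' 0 hc hb ha hr.self_of_nhds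
      hs.self_of_nhds hc' hb' ha' hr' hs'
    have h3 := BF0_deriv c b a r s c' b' a' r' s' 0 hc hb ha hr.self_of_nhds hs.self_of_nhds
    have h := h1.add (((((((hz 5).const_mul 4).mul hF').mul h3)).add ((hz 4).mul h2)).const_mul μ)
    refine h.congr_deriv ?_
    simp only [Pi.mul_apply, Nat.cast_ofNat]
    generalize (k - F 0)⁻¹ = z
    ring
  · have h := (((hz 2).mul hF').const_mul (-m)).sub (hl'.const_mul 16)
    refine h.congr_deriv ?_
    norm_num


/-- directional derivative -/
noncomputable def dd (u : Fin 2 → ℝ) (h : (Fin 2 → ℝ) → ℝ) : (Fin 2 → ℝ) → ℝ := fun x => fderiv ℝ h x u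

/-- The second function is the derivative of the first in direction `w` on `Ω` -/
def LD (Ω : Set (Fin 2 → ℝ)) (w : Fin 2 → ℝ) (h h' : (Fin 2 → ℝ) → ℝ) : Prop :=
  ∀ y ∈ Ω, HasDerivAt (fun t : ℝ => h (y + t • w)) (h' y) 0

/-- smooth on `Ω` -/
def Sm (Ω : Set (Fin 2 → ℝ)) (h : (Fin 2 → ℝ) → ℝ) : Prop := ContDiffOn ℝ (⊤ : ℕ∞) h Ω

section LDsec
variable {Ω : Set (Fin 2 → ℝ)} {u v w : Fin 2 → ℝ} {h h' k k' : (Fin 2 → ℝ) → ℝ}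

lemma Sm.diffAt (hΩ : IsOpen Ω) (hs : Sm Ω h) {y : Fin 2 → ℝ} (hy : y ∈ Ω) :
    DifferentiableAt ℝ h y :=
  (ContDiffOn.differentiableOn hs (by simp)).differentiableAt (hΩ.mem_nhds hy)

lemma Sm.dd (hΩ : IsOpen Ω) (hs : Sm Ω h) : Sm Ω (dd u h) := by
  have : ContDiffOn ℝ (⊤ : ℕ∞) (fderiv ℝ h) Ω := ContDiffOn.fderiv_of_isOpen hs hΩ (by simp)
  exact this.clm_apply contDiffOn_const

lemma line_of_fderiv {y : Fin 2 → ℝ} (hd : DifferentiableAt ℝ h y) (t : ℝ) (x : Fin 2 → ℝ)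
    (hx : x + t • w = y) : HasDerivAt (fun t : ℝ => h (x + t • w)) (dd w h y) t := by
  subst hx
  have h1 : HasDerivAt (fun t : ℝ => x + t • w) w t := by
    have := ((hasDerivAt_id t).smul_const w).const_add x
    simpa using this
  exact hd.hasFDerivAt.comp_hasDerivAt t h1

lemma Sm.ld (hΩ : IsOpen Ω) (hs : Sm Ω h) : LD Ω w h (_root_.dd w h) := by
  intro y hy
  exact line_of_fderiv (hs.diffAt hΩ hy) 0 y (by simp)

lemma LD.at (H : LD Ω w h h') (x : Fin 2 → ℝ) (t : ℝ) (hy : x + t • w ∈ Ω) :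
    HasDerivAt (fun t : ℝ => h (x + t • w)) (h' (x + t • w)) t := by
  have h1 := H _ hy
  have h2 : HasDerivAt (fun s : ℝ => s - t) 1 t := (hasDerivAt_id t).sub_const t
  have h3 := HasDerivAt.comp (h₂ := fun s : ℝ => h (x + t • w + s • w)) (h := fun s : ℝ => s - t) t
    (by simpa using h1) h2
  simp only [mul_one] at h3
  refine h3.congr_of_eventuallyEq (Eventually.of_forall fun s => ?_)
  simp only [Function.comp]
  congr 1
  rw [add_assoc, ← add_smul]; simp

lemma LD.ev (hΩ : IsOpen Ω) (H : LD Ω w h h') {x : Fin 2 → ℝ} (hx : x ∈ Ω) :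
    ∀ᶠ t in 𝓝 (0:ℝ), HasDerivAt (fun t : ℝ => h (x + t • w)) (h' (x + t • w)) t := by
  have hc : ContinuousAt (fun t : ℝ => x + t • w) 0 := by fun_prop
  have : ∀ᶠ t in 𝓝 (0:ℝ), x + t • w ∈ Ω := hc.eventually (hΩ.mem_nhds (by simpa using hx))
  filter_upwards [this] with t ht using H.at x t ht

lemma LD.zero (H : LD Ω w h h') {x : Fin 2 → ℝ} (hx : x ∈ Ω) :
    HasDerivAt (fun t : ℝ => h (x + t • w)) (h' (x + (0:ℝ) • w)) 0 :=
  H.at x 0 (by simpa using hx)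

lemma LD.uniq (hΩ : IsOpen Ω) (H : LD Ω w h h') (K : LD Ω w k k') (e : ∀ y ∈ Ω, h y = k y) :
    ∀ y ∈ Ω, h' y = k' y := by
  intro y hy
  refine (H y hy).unique ((K y hy).congr_of_eventuallyEq ?_)
  have hc : ContinuousAt (fun t : ℝ => y + t • w) 0 := by fun_prop
  have : ∀ᶠ t in 𝓝 (0:ℝ), y + t • w ∈ Ω := hc.eventually (hΩ.mem_nhds (by simpa using hy))
  filter_upwards [this] with t ht using e _ ht

lemma LD.congr (H : LD Ω w h h') (e : ∀ y ∈ Ω, h' y = k' y) : LD Ω w h k' :=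
  fun y hy => (H y hy).congr_deriv (e y hy)

lemma LD.mul (H : LD Ω w h h') (K : LD Ω w k k') :
    LD Ω w (fun y => h y * k y) (fun y => h' y * k y + h y * k' y) := fun y hy => by
  have := (H y hy).mul (K y hy)
  exact this.congr_deriv (by simp)

lemma LD.add (H : LD Ω w h h') (K : LD Ω w k k') :
    LD Ω w (fun y => h y + k y) (fun y => h' y + k' y) := fun y hy => (H y hy).add (K y hy)

lemma LD.sub (H : LD Ω w h h') (K : LD Ω w k k') :
    LD Ω w (fun y => h y - k y) (fun y => h' y - k' y) := fun y hy => (H y hy).sub (K y hy)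

lemma LD.cmul (c : ℝ) (H : LD Ω w h h') :
    LD Ω w (fun y => c * h y) (fun y => c * h' y) := fun y hy => (H y hy).const_mul c

lemma LD.exp (H : LD Ω w h h') :
    LD Ω w (fun y => Real.exp (h y)) (fun y => Real.exp (h y) * h' y) := fun y hy => by
  have := (H y hy).exp
  simpa using this

lemma LD.swap (hΩ : IsOpen Ω) (hs : Sm Ω h) (hs' : Sm Ω h') (H : LD Ω v h h') :
    LD Ω v (_root_.dd u h) (_root_.dd u h') := by
  refine ((hs.dd hΩ).ld hΩ).congr ?_
  intro y hy
  have e1 : ∀ z ∈ Ω, _root_.dd v h z = h' z := (hs.ld hΩ).uniq hΩ H (fun _ _ => rfl)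
  have e2 : _root_.dd u (_root_.dd v h) y = _root_.dd u h' y := by
    unfold _root_.dd
    rw [Filter.EventuallyEq.fderiv_eq (f₁ := fun x => fderiv ℝ h x v) (f := h')]
    filter_upwards [hΩ.mem_nhds hy] with z hz using e1 z hz
  rw [← e2]
  have hc : ContDiffAt ℝ (⊤ : ℕ∞) h y := ContDiffOn.contDiffAt hs (hΩ.mem_nhds hy)
  have hsym := hc.isSymmSndFDerivAt (by
    simp only [minSmoothness_of_isRCLikeNormedField]
    exact WithTop.coe_le_coe.mpr (le_top : (2:ℕ∞) ≤ ⊤))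
  have hdd : DifferentiableAt ℝ (fderiv ℝ h) y := by
    have : ContDiffOn ℝ (⊤ : ℕ∞) (fderiv ℝ h) Ω := ContDiffOn.fderiv_of_isOpen hs hΩ (by simp)
    exact (this.differentiableOn (by simp)).differentiableAt (hΩ.mem_nhds hy)
  have e3 : ∀ a b : Fin 2 → ℝ, _root_.dd a (_root_.dd b h) y = fderiv ℝ (fderiv ℝ h) y a b := by
    intro a b
    have := (hdd.hasFDerivAt.clm_apply (hasFDerivAt_const b y)).fderiv
    unfold _root_.dd
    rw [this]
    simp
  rw [e3, e3]
  exact hsym v u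

end LDsec


section RelSec
variable {K : ℝ} {Ω : Set (Fin 2 → ℝ)} {w w' : Fin 2 → ℝ}
  {a b c l a1 b1 c1 l1 a2 b2 c2 l2 a3 b3 c3 l3 : (Fin 2 → ℝ) → ℝ}

lemma rel_one (hΩ : IsOpen Ω) (ha : LD Ω w a a1) (hb : LD Ω w b b1) (hc : LD Ω w c c1) (hl : LD Ω w l l1)
    (e : ∀ y ∈ Ω, K * Real.exp (-4 * l y) = a y * c y - b y * b y) :
    ∀ y ∈ Ω, K * (Real.exp (-4 * l y) * (-4 * l1 y)) =
      (a1 y * c y + a y * c1 y) - (b1 y * b y + b y * b1 y) :=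
  ((hl.cmul (-4)).exp.cmul K).uniq hΩ ((ha.mul hc).sub (hb.mul hb)) e

lemma rel_two (hΩ : IsOpen Ω) (ha : LD Ω w a a1) (hb : LD Ω w b b1) (hc : LD Ω w c c1) (hl : LD Ω w l l1)
    (ha2 : LD Ω w' a a2) (hb2 : LD Ω w' b b2) (hc2 : LD Ω w' c c2) (hl2 : LD Ω w' l l2)
    (ha3 : LD Ω w' a1 a3) (hb3 : LD Ω w' b1 b3) (hc3 : LD Ω w' c1 c3) (hl3 : LD Ω w' l1 l3)
    (e : ∀ y ∈ Ω, K * Real.exp (-4 * l y) = a y * c y - b y * b y) :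
    ∀ y ∈ Ω, K * ((Real.exp (-4 * l y) * (-4 * l2 y)) * (-4 * l1 y) + Real.exp (-4 * l y) * (-4 * l3 y)) =
      ((a3 y * c y + a1 y * c2 y) + (a2 y * c1 y + a y * c3 y)) -
        ((b3 y * b y + b1 y * b2 y) + (b2 y * b1 y + b y * b3 y)) :=
  (((hl2.cmul (-4)).exp.mul (hl3.cmul (-4))).cmul K).uniq hΩ
    (((ha3.mul hc2).add (ha2.mul hc3)).sub ((hb3.mul hb2).add (hb2.mul hb3)))
    (rel_one hΩ ha hb hc hl e)

lemma pde_one (hΩ : IsOpen Ω) {p q P R Q p' q' P' R' Q' : (Fin 2 → ℝ) → ℝ}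
    (ha : LD Ω w a a1) (hb : LD Ω w b b1) (hc : LD Ω w c c1)
    (hp : LD Ω w p p') (hq : LD Ω w q q') (hP : LD Ω w P P') (hR : LD Ω w R R') (hQ : LD Ω w Q Q')
    (e : ∀ y ∈ Ω, c y * (P y + 3 * (p y * p y)) - 2 * (b y * (R y + 3 * (p y * q y)))
      + a y * (Q y + 3 * (q y * q y)) = 0) :
    ∀ y ∈ Ω, (c1 y * (P y + 3 * (p y * p y)) + c y * (P' y + 3 * (p' y * p y + p y * p' y)))
      - 2 * (b1 y * (R y + 3 * (p y * q y)) + b y * (R' y + 3 * (p' y * q y + p y * q' y)))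
      + (a1 y * (Q y + 3 * (q y * q y)) + a y * (Q' y + 3 * (q' y * q y + q y * q' y))) = 0 :=
  (((hc.mul (hP.add ((hp.mul hp).cmul 3))).sub ((hb.mul (hR.add ((hp.mul hq).cmul 3))).cmul 2)).add
    (ha.mul (hQ.add ((hq.mul hq).cmul 3)))).uniq (k := fun _ => 0) (k' := fun _ => 0) hΩ
    (fun _ _ => hasDerivAt_const _ _) e

end RelSec

/-- the pointwise test function in a frame -/
noncomputable def Nfun (u v : Fin 2 → ℝ) (f l : (Fin 2 → ℝ) → ℝ) (m k : ℝ) (y : Fin 2 → ℝ) : ℝ :=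
  BF (dd v (dd v f) y) (dd u (dd v f) y) (dd u (dd u f) y) (dd u l y) (dd v l y) (dd u l y) (dd v l y)
   + m ^ 2 / 20 * ((k - f y)⁻¹ ^ 4 *
   BF (dd v (dd v f) y) (dd u (dd v f) y) (dd u (dd u f) y) (dd u f y) (dd v f y) (dd u f y) (dd v f y))

lemma lmax_line {Z : (Fin 2 → ℝ) → ℝ} {x : Fin 2 → ℝ} (u : Fin 2 → ℝ) (h : IsLocalMax Z x) :
    IsLocalMax (fun t : ℝ => Z (x + t • u)) 0 := by
  have hc : ContinuousAt (fun t : ℝ => x + t • u) 0 := by fun_prop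
  have h0 : x + (0:ℝ) • u = x := by simp
  have : Tendsto (fun t : ℝ => x + t • u) (𝓝 0) (𝓝 x) := by
    have := hc.tendsto; rwa [h0] at this
  have h2 := this.eventually h
  filter_upwards [h2] with t ht
  rw [h0]; exact ht

set_option maxHeartbeats 2000000 in
lemma key (Ω : Set (Fin 2 → ℝ)) (hΩ : IsOpen Ω) (f l : (Fin 2 → ℝ) → ℝ) (hf : Sm Ω f) (hl : Sm Ω l)
    (u v : Fin 2 → ℝ) (K : ℝ)
    (hrel : ∀ y ∈ Ω, K * Real.exp (-4 * l y) =
      dd u (dd u f) y * dd v (dd v f) y - dd u (dd v f) y * dd u (dd v f) y)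
    (hpde : ∀ y ∈ Ω, dd v (dd v f) y * (dd u (dd u l) y + 3 * (dd u l y * dd u l y))
      - 2 * (dd u (dd v f) y * (dd u (dd v l) y + 3 * (dd u l y * dd v l y)))
      + dd u (dd u f) y * (dd v (dd v l) y + 3 * (dd v l y * dd v l y)) = 0)
    (x : Fin 2 → ℝ) (hx : x ∈ Ω) (m k : ℝ) (hm : 0 < m) (hk : f x < k) (hkm : k - f x ≤ m / 100000)
    (ha : dd u (dd u f) x = 1) (hb : dd u (dd v f) x = 0) (hc : dd v (dd v f) x = 1)
    (hmax : IsLocalMax (fun y => Real.exp (-m * (k - f y)⁻¹ - 16 * l y) * Nfun u v f l m k y) x) :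
    Nfun u v f l m k x ≤ 8000 * (m * (k - f x)⁻¹ ^ 2) := by
  have S : ∀ {h : (Fin 2 → ℝ) → ℝ} (w : Fin 2 → ℝ), Sm Ω h → Sm Ω (dd w h) := fun w hs => hs.dd hΩ
  have L : ∀ {h : (Fin 2 → ℝ) → ℝ} (w : Fin 2 → ℝ), Sm Ω h → LD Ω w h (dd w h) := fun w hs => hs.ld hΩ
  have Wuf : LD Ω v (dd u f) (dd u (dd v f)) := (L v hf).swap hΩ hf (S v hf)
  have Wuuf : LD Ω v (dd u (dd u f)) (dd u (dd u (dd v f))) := Wuf.swap hΩ (S u hf) (S u (S v hf))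
  have Wvf : LD Ω v (dd v f) (dd v (dd v f)) := L v (S v hf)
  have Wuvf : LD Ω v (dd u (dd v f)) (dd u (dd v (dd v f))) := Wvf.swap hΩ (S v hf) (S v (S v hf))
  have Wuuvf : LD Ω v (dd u (dd u (dd v f))) (dd u (dd u (dd v (dd v f)))) :=
    Wuvf.swap hΩ (S u (S v hf)) (S u (S v (S v hf)))
  have Wvvf : LD Ω v (dd v (dd v f)) (dd v (dd v (dd v f))) := L v (S v (S v hf))
  have Wuvvf : LD Ω v (dd u (dd v (dd v f))) (dd u (dd v (dd v (dd v f)))) :=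
    Wvvf.swap hΩ (S v (S v hf)) (S v (S v (S v hf)))
  have Wvvvf : LD Ω v (dd v (dd v (dd v f))) (dd v (dd v (dd v (dd v f)))) := L v (S v (S v (S v hf)))
  have Wl : LD Ω v l (dd v l) := L v hl
  have Wul : LD Ω v (dd u l) (dd u (dd v l)) := Wl.swap hΩ hl (S v hl)
  have Wuul : LD Ω v (dd u (dd u l)) (dd u (dd u (dd v l))) := Wul.swap hΩ (S u hl) (S u (S v hl))
  have Wvl : LD Ω v (dd v l) (dd v (dd v l)) := L v (S v hl)
  have Wuvl : LD Ω v (dd u (dd v l)) (dd u (dd v (dd v l))) := Wvl.swap hΩ (S v hl) (S v (S v hl))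
  have Wvvl : LD Ω v (dd v (dd v l)) (dd v (dd v (dd v l))) := L v (S v (S v hl))
  have Uf := L u hf
  have Uuf := L u (S u hf)
  have Uvf := L u (S v hf)
  have Uuuf := L u (S u (S u hf))
  have Uuvf := L u (S u (S v hf))
  have Uvvf := L u (S v (S v hf))
  have Uuuuf := L u (S u (S u (S u hf)))
  have Uuuvf := L u (S u (S u (S v hf)))
  have Uuvvf := L u (S u (S v (S v hf)))
  have Ul := L u hl
  have Uul := L u (S u hl)
  have Uvl := L u (S v hl)
  have Uuul := L u (S u (S u hl))
  have Uuvl := L u (S u (S v hl))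
  have Uvvl := L u (S v (S v hl))
  have R1 := rel_one hΩ Uuuf Uuvf Uvvf Ul hrel x hx
  have R2 := rel_one hΩ Wuuf Wuvf Wvvf Wl hrel x hx
  have R11 := rel_two hΩ Uuuf Uuvf Uvvf Ul Uuuf Uuvf Uvvf Ul Uuuuf Uuuvf Uuvvf Uul hrel x hx
  have R12 := rel_two hΩ Wuuf Wuvf Wvvf Wl Uuuf Uuvf Uvvf Ul Uuuvf Uuvvf (L u (S v (S v (S v hf)))) Uvl hrel x hx
  have R22 := rel_two hΩ Wuuf Wuvf Wvvf Wl Wuuf Wuvf Wvvf Wl Wuuvf Wuvvf Wvvvf Wvl hrel x hx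
  have P1 := pde_one hΩ Uuuf Uuvf Uvvf Uul Uvl Uuul Uuvl Uvvl hpde x hx
  have P2 := pde_one hΩ Wuuf Wuvf Wvvf Wul Wvl Wuul Wuvl Wvvl hpde x hx
  have P0 := hpde x hx
  have E0 := hrel x hx
  rw [ha, hb, hc] at E0
  have E0' : K * Real.exp (-4 * l x) = 1 := by rw [E0]; ring
  rw [ha, hb, hc] at R1 R2 R11 R12 R22
  rw [ha, hb, hc] at P0 P1 P2
  have hy : k - f (x + (0:ℝ) • u) ≠ 0 := by simp; linarith
  have hy' : k - f (x + (0:ℝ) • v) ≠ 0 := by simp; linarith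
  obtain ⟨N, N1, N2, E1, E2, z, hz, hN, hE1, hE2, hN1, hN2, c1, d1⟩ := line_jets
    _ _ _ _ _ _ _ _ _ _ _ _ _ _ _ _ _ _
    (fun t => dd u (dd u (dd v (dd v f))) (x + t • u)) (fun t => dd u (dd u (dd u (dd v f))) (x + t • u))
    (fun t => dd u (dd u (dd u (dd u f))) (x + t • u)) (fun t => dd u (dd u (dd u l)) (x + t • u))
    (fun t => dd u (dd u (dd v l)) (x + t • u)) (fun t => dd u (dd u (dd u f)) (x + t • u))
    (fun t => dd u (dd u (dd v f)) (x + t • u)) (fun t => dd u (dd u l) (x + t • u))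
    (fun t => dd u (dd u f) (x + t • u)) m (m ^ 2 / 20) k hy
    (Uvvf.ev hΩ hx) (Uuvf.ev hΩ hx) (Uuuf.ev hΩ hx) (Uul.ev hΩ hx) (Uvl.ev hΩ hx)
    (Uuf.ev hΩ hx) (Uvf.ev hΩ hx) (Ul.ev hΩ hx) (Uf.ev hΩ hx)
    (Uuvvf.zero hx) (Uuuvf.zero hx) (Uuuuf.zero hx) (Uuul.zero hx) (Uuvl.zero hx)
    (Uuuf.zero hx) (Uuvf.zero hx) (Uul.zero hx) (Uuf.zero hx) (lmax_line u hmax)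
  obtain ⟨N', N1', N2', E1', E2', z', hz', hN', hE1', hE2', hN1', hN2', c2, d2⟩ := line_jets
    _ _ _ _ _ _ _ _ _ _ _ _ _ _ _ _ _ _
    (fun t => dd v (dd v (dd v (dd v f))) (x + t • v)) (fun t => dd u (dd v (dd v (dd v f))) (x + t • v))
    (fun t => dd u (dd u (dd v (dd v f))) (x + t • v)) (fun t => dd u (dd v (dd v l)) (x + t • v))
    (fun t => dd v (dd v (dd v l)) (x + t • v)) (fun t => dd u (dd v (dd v f)) (x + t • v))
    (fun t => dd v (dd v (dd v f)) (x + t • v)) (fun t => dd v (dd v l) (x + t • v))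
    (fun t => dd v (dd v f) (x + t • v)) m (m ^ 2 / 20) k hy'
    (Wvvf.ev hΩ hx) (Wuvf.ev hΩ hx) (Wuuf.ev hΩ hx) (Wul.ev hΩ hx) (Wvl.ev hΩ hx)
    (Wuf.ev hΩ hx) (Wvf.ev hΩ hx) (Wl.ev hΩ hx) ((L v hf).ev hΩ hx)
    (Wvvvf.zero hx) (Wuvvf.zero hx) (Wuuvf.zero hx) (Wuvl.zero hx) (Wvvl.zero hx)
    (Wuvf.zero hx) (Wvvf.zero hx) (Wvl.zero hx) (Wvf.zero hx) (lmax_line v hmax)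
  simp only [zero_smul, add_zero, ha, hb, hc] at hz hz' hN hE1 hE2 hN1 hN2 hN' hE1' hE2' hN1' hN2'
  have hzz : z' = z := hz'.trans hz.symm
  subst hzz
  have hNN : N' = N := hN'.trans hN.symm
  subst hNN
  have hNx : Nfun u v f l m k x = N' := by rw [hN', hz', Nfun, ha, hb, hc]
  rw [hNx, ← hz']
  have hzpos : 0 < z' := by rw [hz']; exact inv_pos.mpr (by linarith)
  have hmz : m * z' ≠ 0 := by positivity
  have hσg : (m * z')⁻¹ * (m * z' ^ 2) = z' := by field_simp
  have hσ' : (m * z')⁻¹ ≤ 1 / 100000 := by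
    rw [mul_inv, hz', inv_inv, inv_mul_eq_div, div_le_iff₀ hm]; linarith
  have hσ0 : 0 ≤ (m * z')⁻¹ := by positivity
  obtain ⟨g, hg⟩ : ∃ g, g = m * z' ^ 2 := ⟨_, rfl⟩
  obtain ⟨σ, hσ⟩ : ∃ σ, σ = (m * z')⁻¹ := ⟨_, rfl⟩
  rw [← hg] at hσg ⊢
  rw [← hσ] at hσ' hσ0 hσg
  have hg0 : 0 ≤ g := by rw [hg]; positivity
  have e3 : m * z' ^ 3 = σ * g ^ 2 := by linear_combination (-z') * hg - g * hσg
  have e4 : m ^ 2 * z' ^ 4 = g ^ 2 := by rw [hg]; ring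
  have e5 : m ^ 2 * z' ^ 5 = σ * g ^ 3 := by linear_combination z' * e4 - g ^ 2 * hσg
  have e6 : m ^ 2 * z' ^ 6 = σ ^ 2 * g ^ 4 := by
    linear_combination z' * e5 - σ * g ^ 3 * hσg
  clear hmax hz hz' hσ
  refine jets (dd u (dd u (dd u f)) x) (dd u (dd u (dd v f)) x) (dd u (dd v (dd v f)) x) (dd v (dd v (dd v f)) x) (dd u (dd u (dd u (dd u f))) x) (dd u (dd u (dd u (dd v f))) x) (dd u (dd u (dd v (dd v f))) x)
    (dd u (dd v (dd v (dd v f))) x) (dd v (dd v (dd v (dd v f))) x) 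
    (dd u l x) (dd v l x) (dd u (dd u l) x) (dd u (dd v l) x) (dd v (dd v l) x) (dd u (dd u (dd u l)) x) (dd u (dd u (dd v l)) x) (dd u (dd v (dd v l)) x) (dd v (dd v (dd v l)) x)
    (dd u f x) (dd v f x) g σ hg0 hσ0 hσ' ?_ ?_ ?_ ?_ ?_ ?_ ?_ ?_
    N' N1 N2 E1 E2 N1' N2' E1' E2' ?_ ?_ ?_ ?_ ?_ ?_ ?_ ?_ ?_ c1 c2 d1 d2
  rotate_left 8
  · rw [hN]; linear_combination (1/20) * BF 1 0 1 (dd u f x) (dd v f x) (dd u f x) (dd v f x) * e4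
  · rw [hE1]; linear_combination (dd u f x) * hg
  · rw [hE1']; linear_combination (dd v f x) * hg
  · rw [hE2]; linear_combination hg - 2 * (dd u f x) ^ 2 * e3
  · rw [hE2']; linear_combination hg - 2 * (dd v f x) ^ 2 * e3
  · rw [hN1]; linear_combination (4/20) * (dd u f x) * BF 1 0 1 (dd u f x) (dd v f x) (dd u f x) (dd v f x) * e5
      + (1/20) * BF1 1 0 1 (dd u f x) (dd v f x) (dd u (dd v (dd v f)) x) (dd u (dd u (dd v f)) x)
        (dd u (dd u (dd u f)) x) 1 0 * e4
  · rw [hN1']; linear_combination (4/20) * (dd v f x) * BF 1 0 1 (dd u f x) (dd v f x) (dd u f x) (dd v f x) * e5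
      + (1/20) * BF1 1 0 1 (dd u f x) (dd v f x) (dd v (dd v (dd v f)) x) (dd u (dd v (dd v f)) x)
        (dd u (dd u (dd v f)) x) 0 1 * e4
  · rw [hN2]
    generalize BF 1 0 1 (dd u f x) (dd v f x) (dd u f x) (dd v f x) = Q0
    generalize BF1 1 0 1 (dd u f x) (dd v f x) (dd u (dd v (dd v f)) x) (dd u (dd u (dd v f)) x)
        (dd u (dd u (dd u f)) x) 1 0 = Q1
    generalize BF2 1 0 1 (dd u f x) (dd v f x) (dd u (dd v (dd v f)) x) (dd u (dd u (dd v f)) x)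
        (dd u (dd u (dd u f)) x) 1 0 (dd u (dd u (dd v (dd v f))) x) (dd u (dd u (dd u (dd v f))) x) (dd u (dd u (dd u (dd u f))) x) (dd u (dd u (dd u f)) x) (dd u (dd u (dd v f)) x) = Q2
    linear_combination (20/20) * Q0 * (dd u f x) ^ 2 * e6 + (4/20) * Q0 * e5
      + (8/20) * (dd u f x) * Q1 * e5 + (1/20) * Q2 * e4
  · rw [hN2']
    generalize BF 1 0 1 (dd u f x) (dd v f x) (dd u f x) (dd v f x) = Q0
    generalize BF1 1 0 1 (dd u f x) (dd v f x) (dd v (dd v (dd v f)) x) (dd u (dd v (dd v f)) x)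
        (dd u (dd u (dd v f)) x) 0 1 = Q1
    generalize BF2 1 0 1 (dd u f x) (dd v f x) (dd v (dd v (dd v f)) x) (dd u (dd v (dd v f)) x)
        (dd u (dd u (dd v f)) x) 0 1 (dd v (dd v (dd v (dd v f))) x) (dd u (dd v (dd v (dd v f))) x) (dd u (dd u (dd v (dd v f))) x) (dd u (dd v (dd v f)) x) (dd v (dd v (dd v f)) x) = Q2
    linear_combination (20/20) * Q0 * (dd v f x) ^ 2 * e6 + (4/20) * Q0 * e5
      + (8/20) * (dd v f x) * Q1 * e5 + (1/20) * Q2 * e4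
  · linear_combination R1 + 4 * dd u l x * E0'
  · linear_combination R2 + 4 * dd v l x * E0'
  · linear_combination R11 - (16 * dd u l x * dd u l x - 4 * dd u (dd u l) x) * E0'
  · linear_combination R12 - (16 * dd u l x * dd v l x - 4 * dd u (dd v l) x) * E0'
  · linear_combination R22 - (16 * dd v l x * dd v l x - 4 * dd v (dd v l) x) * E0'
  · linear_combination P0
  · linear_combination P1
  · linear_combination P2


section Trans

/-- first basis vector -/
def e0 : Fin 2 → ℝ := Pi.single 0 1
/-- second basis vector -/
def e1 : Fin 2 → ℝ := Pi.single 1 1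

variable {Ω : Set (Fin 2 → ℝ)} {f h : (Fin 2 → ℝ) → ℝ}

lemma dd_lin (u : Fin 2 → ℝ) (h : (Fin 2 → ℝ) → ℝ) :
    dd u h = fun y => u 0 * dd e0 h y + u 1 * dd e1 h y := by
  funext y
  have hu : u = u 0 • e0 + u 1 • e1 := by
    funext i; fin_cases i <;> simp [e0, e1]
  unfold dd
  conv_lhs => rw [hu]
  simp

lemma dd_eq_of_ld (hΩ : IsOpen Ω) {w : Fin 2 → ℝ} {G F F' : (Fin 2 → ℝ) → ℝ}
    (hF : Sm Ω F) (hL : LD Ω w F F') (e : ∀ y ∈ Ω, G y = F y) : ∀ y ∈ Ω, dd w G y = F' y := by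
  intro y hy
  have h1 : dd w G y = dd w F y := by
    unfold dd
    rw [Filter.EventuallyEq.fderiv_eq (f₁ := G) (f := F)]
    filter_upwards [hΩ.mem_nhds hy] with z hz using e z hz
  rw [h1]
  exact (hF.ld hΩ).uniq hΩ hL (fun _ _ => rfl) y hy

lemma dd_symm (hΩ : IsOpen Ω) (hs : Sm Ω h) (u v : Fin 2 → ℝ) :
    ∀ y ∈ Ω, dd v (dd u h) y = dd u (dd v h) y :=
  ((hs.dd hΩ).ld hΩ).uniq hΩ ((hs.ld hΩ).swap hΩ hs (hs.dd hΩ)) (fun _ _ => rfl)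

lemma dd_two (hΩ : IsOpen Ω) (hs : Sm Ω h) (u v : Fin 2 → ℝ) : ∀ y ∈ Ω, dd u (dd v h) y =
    u 0 * v 0 * dd e0 (dd e0 h) y + (u 0 * v 1 + u 1 * v 0) * dd e0 (dd e1 h) y
      + u 1 * v 1 * dd e1 (dd e1 h) y := by
  intro y hy
  have hL : ∀ w, LD Ω w (fun y => v 0 * dd e0 h y + v 1 * dd e1 h y)
      (fun y => v 0 * dd w (dd e0 h) y + v 1 * dd w (dd e1 h) y) := fun w =>
    (((hs.dd hΩ).ld hΩ).cmul _).add (((hs.dd hΩ).ld hΩ).cmul _)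
  have hS : Sm Ω (fun y => v 0 * dd e0 h y + v 1 * dd e1 h y) := by
    rw [← dd_lin v h]; exact hs.dd hΩ
  have h1 : ∀ w, dd w (dd v h) y = v 0 * dd w (dd e0 h) y + v 1 * dd w (dd e1 h) y := fun w =>
    dd_eq_of_ld hΩ hS (hL w) (fun z _ => by rw [dd_lin v h]) y hy
  rw [dd_lin u (dd v h)]
  simp only [h1]
  rw [dd_symm hΩ hs e0 e1 y hy]
  ring

lemma frame_N (hΩ : IsOpen Ω) (hf : Sm Ω f) {l : (Fin 2 → ℝ) → ℝ} (u v : Fin 2 → ℝ) (m k : ℝ) :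
    ∀ y ∈ Ω, Nfun u v f l m k y = (u 0 * v 1 - u 1 * v 0) ^ 2 * Nfun e0 e1 f l m k y := by
  intro y hy
  unfold Nfun
  rw [dd_two hΩ hf u u y hy, dd_two hΩ hf u v y hy, dd_two hΩ hf v v y hy,
    dd_lin u l, dd_lin v l, dd_lin u f, dd_lin v f]
  simp only [BF]
  ring

/-- log of rho -/
noncomputable def lrho (f : (Fin 2 → ℝ) → ℝ) : (Fin 2 → ℝ) → ℝ := fun y => Real.log (rho f y)

/-- the determinant in the standard frame -/
noncomputable def dt (f : (Fin 2 → ℝ) → ℝ) : (Fin 2 → ℝ) → ℝ := fun y =>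
  dd e0 (dd e0 f) y * dd e1 (dd e1 f) y - dd e0 (dd e1 f) y * dd e0 (dd e1 f) y

lemma hess_eq (hΩ : IsOpen Ω) (hf : Sm Ω f) : ∀ y ∈ Ω, hess f y =
    !![dd e0 (dd e0 f) y, dd e0 (dd e1 f) y; dd e0 (dd e1 f) y, dd e1 (dd e1 f) y] := by
  intro y hy
  have h1 := dd_symm hΩ hf e0 e1 y hy
  ext i j
  fin_cases i <;> fin_cases j
  · rfl
  · rfl
  · exact h1
  · rfl

lemma det_eq (hΩ : IsOpen Ω) (hf : Sm Ω f) : ∀ y ∈ Ω, (hess f y).det = dt f y := by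
  intro y hy
  rw [hess_eq hΩ hf y hy, Matrix.det_fin_two_of, dt]

lemma pos_of (hΩ : IsOpen Ω) (hf : Sm Ω f) (hp : ∀ x ∈ Ω, (hess f x).PosDef) : ∀ y ∈ Ω,
    0 < dd e0 (dd e0 f) y ∧ 0 < dt f y := by
  intro y hy
  refine ⟨?_, ?_⟩
  · have := (hp y hy).diag_pos (i := 0)
    rw [hess_eq hΩ hf y hy] at this
    simpa using this
  · rw [← det_eq hΩ hf y hy]; exact (hp y hy).det_pos

lemma rho_eq (hΩ : IsOpen Ω) (hf : Sm Ω f) (hp : ∀ x ∈ Ω, (hess f x).PosDef) : ∀ y ∈ Ω,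
    rho f y = Real.exp (lrho f y) ∧ lrho f y = -(1/4) * Real.log (dt f y) ∧
      dt f y = Real.exp (-4 * lrho f y) ∧ 0 < rho f y := by
  intro y hy
  have hd := (pos_of hΩ hf hp y hy).2
  have hr : rho f y = dt f y ^ (-(1:ℝ)/4) := by
    unfold rho; rw [det_eq hΩ hf y hy]; norm_num
  have hrp : 0 < rho f y := by rw [hr]; exact Real.rpow_pos_of_pos hd _
  have hl : lrho f y = -(1/4) * Real.log (dt f y) := by
    unfold lrho; rw [hr, Real.log_rpow hd]; ring
  refine ⟨?_, hl, ?_, hrp⟩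
  · unfold lrho; rw [Real.exp_log hrp]
  · rw [hl]
    have : -4 * (-(1/4) * Real.log (dt f y)) = Real.log (dt f y) := by ring
    rw [this, Real.exp_log hd]

lemma sm_dt (hΩ : IsOpen Ω) (hf : Sm Ω f) : Sm Ω (dt f) := by
  have h1 : Sm Ω (dd e0 (dd e0 f)) := (hf.dd hΩ).dd hΩ
  have h2 : Sm Ω (dd e0 (dd e1 f)) := (hf.dd hΩ).dd hΩ
  have h3 : Sm Ω (dd e1 (dd e1 f)) := (hf.dd hΩ).dd hΩ
  exact (ContDiffOn.mul h1 h3).sub (ContDiffOn.mul h2 h2)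

lemma sm_lrho (hΩ : IsOpen Ω) (hf : Sm Ω f) (hp : ∀ x ∈ Ω, (hess f x).PosDef) : Sm Ω (lrho f) := by
  have h1 : ContDiffOn ℝ (⊤ : ℕ∞) (fun y => -(1/4) * Real.log (dt f y)) Ω :=
    contDiffOn_const.mul (ContDiffOn.log (sm_dt hΩ hf) (fun y hy => (pos_of hΩ hf hp y hy).2.ne'))
  exact h1.congr fun y hy => (rho_eq hΩ hf hp y hy).2.1

lemma sm_exp {l : (Fin 2 → ℝ) → ℝ} (hl : Sm Ω l) (c : ℝ) : Sm Ω (fun y => Real.exp (c * l y)) :=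
  ContDiffOn.exp (contDiffOn_const.mul hl)

lemma pd_rho (hΩ : IsOpen Ω) (hf : Sm Ω f) (hp : ∀ x ∈ Ω, (hess f x).PosDef) (w : Fin 2 → ℝ) :
    ∀ y ∈ Ω, dd w (rho f) y = rho f y * dd w (lrho f) y := by
  intro y hy
  have hl := sm_lrho hΩ hf hp
  rw [dd_eq_of_ld hΩ (sm_exp hl 1) ((hl.ld hΩ (w := w)).cmul 1).exp
    (fun z hz => by rw [one_mul]; exact (rho_eq hΩ hf hp z hz).1) y hy, (rho_eq hΩ hf hp y hy).1]
  simp only [one_mul]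

lemma inv_hess (hΩ : IsOpen Ω) (hf : Sm Ω f) : ∀ y ∈ Ω, (hess f y)⁻¹ =
    (dt f y)⁻¹ • !![dd e1 (dd e1 f) y, -dd e0 (dd e1 f) y; -dd e0 (dd e1 f) y, dd e0 (dd e0 f) y] := by
  intro y hy
  rw [Matrix.inv_def, det_eq hΩ hf y hy, Ring.inverse_eq_inv', hess_eq hΩ hf y hy,
    Matrix.adjugate_fin_two_of]

lemma phi_eq (hΩ : IsOpen Ω) (hf : Sm Ω f) (hp : ∀ x ∈ Ω, (hess f x).PosDef) : ∀ y ∈ Ω,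
    Phi f y = rho f y ^ 4 * BF (dd e1 (dd e1 f) y) (dd e0 (dd e1 f) y) (dd e0 (dd e0 f) y)
      (dd e0 (lrho f) y) (dd e1 (lrho f) y) (dd e0 (lrho f) y) (dd e1 (lrho f) y) := by
  intro y hy
  have h0 : pd 0 (rho f) y = rho f y * dd e0 (lrho f) y := pd_rho hΩ hf hp e0 y hy
  have h1 : pd 1 (rho f) y = rho f y * dd e1 (lrho f) y := pd_rho hΩ hf hp e1 y hy
  obtain ⟨hr, -, hd, hrp⟩ := rho_eq hΩ hf hp y hy
  have hd4 : (dt f y)⁻¹ = rho f y ^ 4 := by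
    rw [hd, hr, ← Real.exp_neg, ← Real.exp_nat_mul]; congr 1; push_cast; ring
  unfold Phi gradSq
  rw [inv_hess hΩ hf y hy, hd4]
  simp only [Fin.sum_univ_two, h0, h1, Matrix.smul_apply, smul_eq_mul, BF]
  simp
  field_simp
  ring

lemma pde_eq (hΩ : IsOpen Ω) (hf : Sm Ω f) (hp : ∀ x ∈ Ω, (hess f x).PosDef) (hpde : PDE2 f 0 Ω) :
    ∀ y ∈ Ω, dd e1 (dd e1 f) y * (dd e0 (dd e0 (lrho f)) y + 3 * (dd e0 (lrho f) y * dd e0 (lrho f) y))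
      - 2 * (dd e0 (dd e1 f) y * (dd e0 (dd e1 (lrho f)) y + 3 * (dd e0 (lrho f) y * dd e1 (lrho f) y)))
      + dd e0 (dd e0 f) y * (dd e1 (dd e1 (lrho f)) y + 3 * (dd e1 (lrho f) y * dd e1 (lrho f) y)) = 0 := by
  intro y hy
  have hl := sm_lrho hΩ hf hp
  have h := hpde y hy
  have hds : 0 < Real.sqrt (hess f y).det := Real.sqrt_pos.mpr (hp y hy).det_pos
  unfold calabiLap at h
  simp only [neg_zero, zero_mul, zero_div] at h
  have h2 := (mul_eq_zero.mp h).resolve_left (inv_ne_zero hds.ne')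
  simp only [Fin.sum_univ_two] at h2
  have hco : ∀ z ∈ Ω, Real.sqrt (hess f z).det * (dt f z)⁻¹ * rho f z = Real.exp (3 * lrho f z) := by
    intro z hz
    obtain ⟨hr, -, hd, hrp⟩ := rho_eq hΩ hf hp z hz
    rw [det_eq hΩ hf z hz, hd, hr]
    have : Real.exp (-4 * lrho f z) = Real.exp (-2 * lrho f z) ^ 2 := by
      rw [← Real.exp_nat_mul]; congr 1; push_cast; ring
    rw [this, Real.sqrt_sq (Real.exp_pos _).le, ← this, ← Real.exp_neg, ← Real.exp_add, ← Real.exp_add]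
    congr 1; ring
  have S2 : ∀ a b : Fin 2 → ℝ, Sm Ω (dd a (dd b f)) := fun a b => (hf.dd hΩ).dd hΩ
  have hE := sm_exp hl 3
  have LE : ∀ w, LD Ω w (fun y => Real.exp (3 * lrho f y)) _ := fun w => ((hl.ld hΩ (w := w)).cmul 3).exp
  have SF : ∀ a b c : Fin 2 → ℝ, Sm Ω (fun z => Real.exp (3 * lrho f z) * (dd a (dd b f) z * dd c (lrho f) z)) :=
    fun a b c => ContDiffOn.mul hE (ContDiffOn.mul (S2 a b) (hl.dd hΩ))
  have SFn : ∀ a b c : Fin 2 → ℝ, Sm Ω (fun z => (-1) * (Real.exp (3 * lrho f z) * (dd a (dd b f) z * dd c (lrho f) z))) :=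
    fun a b c => contDiffOn_const.mul (SF a b c)
  have LF : ∀ a b c w : Fin 2 → ℝ, LD Ω w (fun z => Real.exp (3 * lrho f z) * (dd a (dd b f) z * dd c (lrho f) z)) _ :=
    fun a b c w => (LE w).mul (((S2 a b).ld hΩ).mul ((hl.dd hΩ).ld hΩ))
  have g00 := dd_eq_of_ld hΩ (w := e0) (SF e1 e1 e0) (LF e1 e1 e0 e0)
    (G := fun y => Real.sqrt (hess f y).det * (hess f y)⁻¹ 0 0 * pd 0 (rho f) y)
    (fun z hz => by
      have h0 : pd 0 (rho f) z = rho f z * dd e0 (lrho f) z := pd_rho hΩ hf hp e0 z hz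
      rw [← hco z hz, h0, inv_hess hΩ hf z hz]; simp; ring) y hy
  have g01 := dd_eq_of_ld hΩ (w := e0) (SFn e0 e1 e1) ((LF e0 e1 e1 e0).cmul (-1))
    (G := fun y => Real.sqrt (hess f y).det * (hess f y)⁻¹ 0 1 * pd 1 (rho f) y)
    (fun z hz => by
      have h0 : pd 1 (rho f) z = rho f z * dd e1 (lrho f) z := pd_rho hΩ hf hp e1 z hz
      rw [← hco z hz, h0, inv_hess hΩ hf z hz]; simp; ring) y hy
  have g10 := dd_eq_of_ld hΩ (w := e1) (SFn e0 e1 e0) ((LF e0 e1 e0 e1).cmul (-1))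
    (G := fun y => Real.sqrt (hess f y).det * (hess f y)⁻¹ 1 0 * pd 0 (rho f) y)
    (fun z hz => by
      have h0 : pd 0 (rho f) z = rho f z * dd e0 (lrho f) z := pd_rho hΩ hf hp e0 z hz
      rw [← hco z hz, h0, inv_hess hΩ hf z hz]; simp; ring) y hy
  have g11 := dd_eq_of_ld hΩ (w := e1) (SF e0 e0 e1) (LF e0 e0 e1 e1)
    (G := fun y => Real.sqrt (hess f y).det * (hess f y)⁻¹ 1 1 * pd 1 (rho f) y)
    (fun z hz => by
      have h0 : pd 1 (rho f) z = rho f z * dd e1 (lrho f) z := pd_rho hΩ hf hp e1 z hz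
      rw [← hco z hz, h0, inv_hess hΩ hf z hz]; simp; ring) y hy
  have h3 := (congrArg₂ (· + ·) (congrArg₂ (· + ·) g00 g01) (congrArg₂ (· + ·) g10 g11)).symm.trans h2
  have hpos := Real.exp_pos (3 * lrho f y)
  have s1 : dd e1 (dd e0 (lrho f)) y = dd e0 (dd e1 (lrho f)) y := dd_symm hΩ hl e0 e1 y hy
  have s2 : dd e1 (dd e0 (dd e1 f)) y = dd e0 (dd e1 (dd e1 f)) y := dd_symm hΩ (hf.dd hΩ) e0 e1 y hy
  have s3 : dd e1 (dd e0 (dd e0 f)) y = dd e0 (dd e0 (dd e1 f)) y :=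
    (((hf.dd hΩ).dd hΩ).ld hΩ).uniq hΩ (((hf.ld hΩ).swap hΩ hf (hf.dd hΩ)).swap hΩ (hf.dd hΩ) ((hf.dd hΩ).dd hΩ))
      (fun _ _ => rfl) y hy
  rw [s1, s2, s3] at h3
  have h4 : Real.exp (3 * lrho f y) * (dd e1 (dd e1 f) y * (dd e0 (dd e0 (lrho f)) y + 3 * (dd e0 (lrho f) y * dd e0 (lrho f) y))
      - 2 * (dd e0 (dd e1 f) y * (dd e0 (dd e1 (lrho f)) y + 3 * (dd e0 (lrho f) y * dd e1 (lrho f) y)))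
      + dd e0 (dd e0 f) y * (dd e1 (dd e1 (lrho f)) y + 3 * (dd e1 (lrho f) y * dd e1 (lrho f) y))) = 0 := by
    linear_combination h3
  exact (mul_eq_zero.mp h4).resolve_left hpos.ne'

end Trans


section Fin
variable {Ω : Set (Fin 2 → ℝ)} {f : (Fin 2 → ℝ) → ℝ}

lemma exp_sq_le (t : ℝ) (ht : 0 ≤ t) : Real.exp (-t) * t ^ 2 ≤ 2 := by
  have h := Real.quadratic_le_exp_of_nonneg ht
  rw [Real.exp_neg, inv_mul_le_iff₀ (Real.exp_pos t)]
  nlinarith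

lemma at_max (hΩ : IsOpen Ω) (hf : Sm Ω f) (hp : ∀ x ∈ Ω, (hess f x).PosDef) (hpde : PDE2 f 0 Ω)
    (b : ℝ) (hb : ∀ x ∈ Ω, 1 / rho f x ≤ b)
    (x : Fin 2 → ℝ) (hx : x ∈ Ω) (m k : ℝ) (hm : 0 < m) (hk : f x < k) (hkm : k - f x ≤ m / 100000)
    (hmax : IsLocalMax (fun y => Real.exp (-m * (k - f y)⁻¹ - 16 * lrho f y) *
      Nfun e0 e1 f (lrho f) m k y) x) :
    Real.exp (-m * (k - f x)⁻¹ - 16 * lrho f x) * Nfun e0 e1 f (lrho f) m k x ≤ 16000 * b ^ 20 / m := by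
  have hl := sm_lrho hΩ hf hp
  obtain ⟨ha, hd⟩ := pos_of hΩ hf hp x hx
  obtain ⟨u, v, hK, hu, huv, hv⟩ : ∃ u v : Fin 2 → ℝ, (u 0 * v 1 - u 1 * v 0) ^ 2 = (dt f x)⁻¹ ∧
      dd u (dd u f) x = 1 ∧ dd u (dd v f) x = 0 ∧ dd v (dd v f) x = 1 := by
    have hs1 : Real.sqrt (dd e0 (dd e0 f) x) ^ 2 = dd e0 (dd e0 f) x := Real.sq_sqrt ha.le
    have hs2 : Real.sqrt (dt f x) ^ 2 = dt f x := Real.sq_sqrt hd.le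
    have hp1 : 0 < Real.sqrt (dd e0 (dd e0 f) x) := Real.sqrt_pos.mpr ha
    have hp2 : 0 < Real.sqrt (dt f x) := Real.sqrt_pos.mpr hd
    generalize Real.sqrt (dd e0 (dd e0 f) x) = s at *
    generalize Real.sqrt (dt f x) = r at *
    refine ⟨![1 / s, 0], ![-dd e0 (dd e1 f) x / (s * r), dd e0 (dd e0 f) x / (s * r)], ?_, ?_, ?_, ?_⟩
    · rw [← hs2, ← hs1]; simp; field_simp
    · rw [dd_two hΩ hf _ _ x hx]; simp; rw [← hs1]; field_simp
    · rw [dd_two hΩ hf _ _ x hx]; simp; field_simp; ring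
    · rw [dd_two hΩ hf _ _ x hx]
      have : dt f x = dd e0 (dd e0 f) x * dd e1 (dd e1 f) x - dd e0 (dd e1 f) x * dd e0 (dd e1 f) x := rfl
      rw [this] at hs2
      simp
      field_simp
      rw [hs1, hs2]; ring
  obtain ⟨K, hKd⟩ : ∃ K, K = (u 0 * v 1 - u 1 * v 0) ^ 2 := ⟨_, rfl⟩
  have hKp : 0 < K := by rw [hKd, hK]; exact inv_pos.mpr hd
  have hrel : ∀ y ∈ Ω, K * Real.exp (-4 * lrho f y) =
      dd u (dd u f) y * dd v (dd v f) y - dd u (dd v f) y * dd u (dd v f) y := by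
    intro y hy
    rw [← (rho_eq hΩ hf hp y hy).2.2.1, hKd, dt, dd_two hΩ hf u u y hy, dd_two hΩ hf u v y hy,
      dd_two hΩ hf v v y hy]
    ring
  have hpd : ∀ y ∈ Ω, dd v (dd v f) y * (dd u (dd u (lrho f)) y + 3 * (dd u (lrho f) y * dd u (lrho f) y))
      - 2 * (dd u (dd v f) y * (dd u (dd v (lrho f)) y + 3 * (dd u (lrho f) y * dd v (lrho f) y)))
      + dd u (dd u f) y * (dd v (dd v (lrho f)) y + 3 * (dd v (lrho f) y * dd v (lrho f) y)) = 0 := by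
    intro y hy
    have h := pde_eq hΩ hf hp hpde y hy
    rw [dd_two hΩ hf u u y hy, dd_two hΩ hf u v y hy, dd_two hΩ hf v v y hy,
      dd_two hΩ hl u u y hy, dd_two hΩ hl u v y hy, dd_two hΩ hl v v y hy, dd_lin u (lrho f), dd_lin v (lrho f)]
    linear_combination (u 0 * v 1 - u 1 * v 0) ^ 2 * h
  have hm2 : IsLocalMax (fun y => Real.exp (-m * (k - f y)⁻¹ - 16 * lrho f y) *
      Nfun u v f (lrho f) m k y) x := by
    filter_upwards [hmax, hΩ.mem_nhds hx] with y h1 hy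
    rw [frame_N hΩ hf u v m k y hy, frame_N hΩ hf u v m k x hx, ← hKd]
    have := mul_le_mul_of_nonneg_left h1 hKp.le
    linarith
  have hkey := key Ω hΩ f (lrho f) hf hl u v K hrel hpd x hx m k hm hk hkm hu huv hv hm2
  rw [frame_N hΩ hf u v m k x hx, hK] at hkey
  obtain ⟨hr, -, hdt, hrp⟩ := rho_eq hΩ hf hp x hx
  have hN : Nfun e0 e1 f (lrho f) m k x ≤ dt f x * (8000 * (m * (k - f x)⁻¹ ^ 2)) := by
    rwa [inv_mul_le_iff₀ hd] at hkey
  have hexp : Real.exp (-m * (k - f x)⁻¹ - 16 * lrho f x) * dt f x =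
      Real.exp (-(m * (k - f x)⁻¹)) * (1 / rho f x) ^ 20 := by
    rw [hdt, hr, ← Real.exp_add, one_div, ← Real.exp_neg, ← Real.exp_nat_mul, ← Real.exp_add]
    congr 1; push_cast; ring
  have hz : 0 < (k - f x)⁻¹ := inv_pos.mpr (by linarith)
  have hsq := exp_sq_le (m * (k - f x)⁻¹) (by positivity)
  have hb20 : (1 / rho f x) ^ 20 ≤ b ^ 20 := pow_le_pow_left₀ (by positivity) (hb x hx) 20
  have hb0 : 0 ≤ (1 / rho f x) ^ 20 := by positivity
  calc _ ≤ Real.exp (-m * (k - f x)⁻¹ - 16 * lrho f x) * (dt f x * (8000 * (m * (k - f x)⁻¹ ^ 2))) :=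
        mul_le_mul_of_nonneg_left hN (Real.exp_pos _).le
    _ = (Real.exp (-(m * (k - f x)⁻¹)) * (m * (k - f x)⁻¹) ^ 2) * (8000 * (1 / rho f x) ^ 20 / m) := by
        rw [← mul_assoc, hexp]; field_simp
    _ ≤ 2 * (8000 * (1 / rho f x) ^ 20 / m) := mul_le_mul_of_nonneg_right hsq (by positivity)
    _ ≤ 2 * (8000 * b ^ 20 / m) := by gcongr
    _ = _ := by ring

lemma bound_k (hΩ : IsOpen Ω) (hf : Sm Ω f) (hp : ∀ x ∈ Ω, (hess f x).PosDef) (hpde : PDE2 f 0 Ω)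
    (hcomp : IsCompact (closure Ω)) (hcont : ContinuousOn f (closure Ω)) (C : ℝ) (hfr : ∀ x ∈ frontier Ω, f x = C)
    (hf0 : ∀ x ∈ Ω, 0 ≤ f x)
    (b : ℝ) (hb0 : 0 < b) (hb : ∀ x ∈ Ω, 1 / rho f x ≤ b) (m k : ℝ) (hm : 0 < m) (hkC : k < C)
    (hCm : C ≤ m / 100000) (y : Fin 2 → ℝ) (hy : y ∈ Ω) (hyk : f y < k) :
    Real.exp (-m * (k - f y)⁻¹ - 16 * lrho f y) * Nfun e0 e1 f (lrho f) m k y ≤ 16000 * b ^ 20 / m := by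
  have hl := sm_lrho hΩ hf hp
  let T : Set (Fin 2 → ℝ) := closure Ω ∩ f ⁻¹' (Set.Iic k)
  have hTc : IsCompact T :=
    hcomp.of_isClosed_subset (hcont.preimage_isClosed_of_isClosed isClosed_closure isClosed_Iic)
      Set.inter_subset_left
  have hTΩ : T ⊆ Ω := by
    intro z hz
    by_contra hzn
    have : z ∈ frontier Ω := by
      rw [hΩ.frontier_eq]; exact ⟨hz.1, hzn⟩
    have h1 := hfr z this
    have h2 : f z ≤ k := hz.2
    linarith
  have hyT : y ∈ T := ⟨subset_closure hy, hyk.le⟩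
  let Zh : (Fin 2 → ℝ) → ℝ := fun y => Real.exp (-16 * lrho f y) *
    (expNegInvGlue ((k - f y) / m) *
      BF (dd e1 (dd e1 f) y) (dd e0 (dd e1 f) y) (dd e0 (dd e0 f) y) (dd e0 (lrho f) y) (dd e1 (lrho f) y)
        (dd e0 (lrho f) y) (dd e1 (lrho f) y)
    + (m ^ 2 / 20 * m⁻¹ ^ 4) * (((Polynomial.X ^ 4 : Polynomial ℝ).eval ((k - f y) / m)⁻¹ *
        expNegInvGlue ((k - f y) / m)) *
      BF (dd e1 (dd e1 f) y) (dd e0 (dd e1 f) y) (dd e0 (dd e0 f) y) (dd e0 f y) (dd e1 f y)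
        (dd e0 f y) (dd e1 f y)))
  have hZh : ∀ z, f z < k → Zh z = Real.exp (-m * (k - f z)⁻¹ - 16 * lrho f z) * Nfun e0 e1 f (lrho f) m k z := by
    intro z hz
    have hpos : 0 < (k - f z) / m := div_pos (by linarith) hm
    have hne : k - f z ≠ 0 := by linarith
    have h1 : expNegInvGlue ((k - f z) / m) = Real.exp (-m * (k - f z)⁻¹) := by
      rw [expNegInvGlue, if_neg (not_le.mpr hpos)]
      congr 1; rw [inv_div, div_eq_mul_inv]; ring
    have h2 : (m⁻¹ ^ 4) * (((k - f z) / m)⁻¹) ^ 4 = (k - f z)⁻¹ ^ 4 := by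
      field_simp
    simp only [Zh, Nfun]
    rw [h1, sub_eq_add_neg (-m * (k - f z)⁻¹), Real.exp_add, Polynomial.eval_pow, Polynomial.eval_X, ← h2]
    rw [show -(16 * lrho f z) = -16 * lrho f z by ring]
    ring
  have hcS : ∀ {h : (Fin 2 → ℝ) → ℝ}, Sm Ω h → ContinuousOn h T := fun hs =>
    (ContDiffOn.continuousOn hs).mono hTΩ
  have c1 := hcS hl
  have c2 := hcS hf
  have c3 := hcS (hl.dd hΩ (u := e0))
  have c4 := hcS (hl.dd hΩ (u := e1))
  have c5 := hcS (hf.dd hΩ (u := e0))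
  have c6 := hcS (hf.dd hΩ (u := e1))
  have c7 := hcS ((hf.dd hΩ (u := e0)).dd hΩ (u := e0))
  have c8 := hcS ((hf.dd hΩ (u := e1)).dd hΩ (u := e0))
  have c9 := hcS ((hf.dd hΩ (u := e1)).dd hΩ (u := e1))
  have c10 : ContinuousOn (fun y => (k - f y) / m) T := (continuousOn_const.sub c2).div_const m
  have c11 : ContinuousOn (fun y => expNegInvGlue ((k - f y) / m)) T :=
    (expNegInvGlue.contDiff (n := 0)).continuous.comp_continuousOn c10
  have c12 : ContinuousOn (fun y => (Polynomial.X ^ 4 : Polynomial ℝ).eval ((k - f y) / m)⁻¹ *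
        expNegInvGlue ((k - f y) / m)) T :=
    (expNegInvGlue.continuous_polynomial_eval_inv_mul (Polynomial.X ^ 4)).comp_continuousOn c10
  have cBF : ∀ {p q : (Fin 2 → ℝ) → ℝ}, ContinuousOn p T → ContinuousOn q T → ContinuousOn (fun y =>
      BF (dd e1 (dd e1 f) y) (dd e0 (dd e1 f) y) (dd e0 (dd e0 f) y) (p y) (q y) (p y) (q y)) T := by
    intro p q hp hq
    simp only [BF]
    exact (((c9.mul hp).mul hp).sub (c8.mul ((hp.mul hq).add (hq.mul hp)))).add ((c7.mul hq).mul hq)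
  have hZc : ContinuousOn Zh T :=
    ((continuousOn_const.mul c1).rexp).mul ((c11.mul (cBF c3 c4)).add
      (continuousOn_const.mul (c12.mul (cBF c5 c6))))
  obtain ⟨x, hxT, hxmax⟩ := hTc.exists_isMaxOn ⟨y, hyT⟩ hZc
  have hxy : Zh y ≤ Zh x := hxmax hyT
  rw [← hZh y hyk]
  refine hxy.trans ?_
  have hxk : f x ≤ k := hxT.2
  rcases hxk.eq_or_lt with he | hlt
  · have : Zh x = 0 := by
      simp only [Zh, he, sub_self, zero_div, expNegInvGlue.zero]; ring
    rw [this]; positivity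
  · rw [hZh x hlt]
    have hx := hTΩ hxT
    refine at_max hΩ hf hp hpde b hb x hx m k hm hlt ?_ ?_
    · linarith [hf0 x hx]
    · have hfc : ContinuousAt f x := (ContDiffOn.continuousOn hf).continuousAt (hΩ.mem_nhds hx)
      filter_upwards [hΩ.mem_nhds hx, hfc.eventually_lt_const hlt] with z hz hzk
      rw [← hZh x hlt, ← hZh z hzk]
      exact hxmax ⟨subset_closure hz, le_of_lt hzk⟩

lemma f_lt (hΩ : IsOpen Ω) (hf : Sm Ω f) (hp : ∀ x ∈ Ω, (hess f x).PosDef)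
    (hcomp : IsCompact (closure Ω)) (hcont : ContinuousOn f (closure Ω)) (C : ℝ) (hfr : ∀ x ∈ frontier Ω, f x = C) :
    ∀ y ∈ Ω, f y < C := by
  have hno : ∀ p ∈ Ω, ¬ IsLocalMax f p := by
    intro p hpΩ hmax
    have hL : LD Ω e0 f (dd e0 f) := hf.ld hΩ
    have hL2 : LD Ω e0 (dd e0 f) (dd e0 (dd e0 f)) := (hf.dd hΩ).ld hΩ
    have h1 := lmax_line e0 hmax
    have h2 := line_test (fun t => f (p + t • e0)) (fun _ => 0) _ (fun _ => 0) _ 0 (hL.ev hΩ hpΩ)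
      (Eventually.of_forall fun t => hasDerivAt_const _ _) (hL2.zero hpΩ) (hasDerivAt_const _ _)
      (by simpa using h1)
    have h3 := h2.2
    simp at h3
    linarith [(pos_of hΩ hf hp p hpΩ).1]
  intro y hy
  by_contra hcon
  push Not at hcon
  obtain ⟨x, hx, hxmax⟩ := hcomp.exists_isMaxOn ⟨y, subset_closure hy⟩ hcont
  have hloc : ∀ p ∈ Ω, f x ≤ f p → IsLocalMax f p := by
    intro p hpΩ hle
    filter_upwards [hΩ.mem_nhds hpΩ] with z hz
    exact (hxmax (subset_closure hz)).trans hle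
  by_cases hxΩ : x ∈ Ω
  · exact hno x hxΩ (hloc x hxΩ le_rfl)
  · have : f x = C := hfr x (by rw [hΩ.frontier_eq]; exact ⟨hx, hxΩ⟩)
    exact hno y hy (hloc y hy (by rw [this]; exact hcon))

lemma main_bound (C b m : ℝ) (hb0 : 0 < b) (hm : 0 < m) (hCm : C ≤ m / 100000)
    (hnd : NormalizedDomain Ω) (hS : SClass Ω C f) (hpde : PDE2 f 0 Ω)
    (hb : ∀ x ∈ Ω, 1 / rho f x ≤ b) (y : Fin 2 → ℝ) (hy : y ∈ Ω) :
    Real.exp (-m / (C - f y)) * Phi f y / (rho f y) ^ (20:ℝ) ≤ 16000 * b ^ 20 / m := by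
  obtain ⟨hΩ, -, -, hsub⟩ := hnd
  obtain ⟨hf, hp, hinf, hcont, hfr⟩ := hS
  have hbd : Bornology.IsBounded Ω := by
    rw [isBounded_iff_forall_norm_le]
    refine ⟨1, fun x hx => ?_⟩
    have h1 : (x 0) ^ 2 + (x 1) ^ 2 < 1 ^ 2 := hsub hx
    rw [pi_norm_le_iff_of_nonneg zero_le_one]
    intro i
    rw [Real.norm_eq_abs, abs_le]
    fin_cases i
    · constructor <;> simp <;> nlinarith [sq_nonneg (x 1)]
    · constructor <;> simp <;> nlinarith [sq_nonneg (x 0)]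
  have hcomp : IsCompact (closure Ω) := hbd.isCompact_closure
  have hlt := f_lt hΩ hf hp hcomp hcont C hfr
  have hf0 : ∀ x ∈ Ω, 0 ≤ f x := by
    intro x hx
    rw [← hinf]
    refine csInf_le ?_ ⟨x, hx, rfl⟩
    exact (hcomp.image_of_continuousOn hcont).bddBelow.mono (Set.image_mono subset_closure)
  have hfy := hlt y hy
  obtain ⟨hr, -, hdt, hrp⟩ := rho_eq hΩ hf hp y hy
  obtain ⟨ha, hd⟩ := pos_of hΩ hf hp y hy
  have hlow : ∀ k, f y < k → k < C →
      Real.exp (-m * (k - f y)⁻¹) * (Phi f y / (rho f y) ^ (20:ℝ)) ≤ 16000 * b ^ 20 / m := by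
    intro k hk1 hk2
    refine le_trans ?_ (bound_k hΩ hf hp hpde hcomp hcont C hfr hf0 b hb0 hb m k hm hk2 hCm y hy hk1)
    have h1 : Phi f y / (rho f y) ^ (20:ℝ) = Real.exp (-16 * lrho f y) *
        BF (dd e1 (dd e1 f) y) (dd e0 (dd e1 f) y) (dd e0 (dd e0 f) y)
      (dd e0 (lrho f) y) (dd e1 (lrho f) y) (dd e0 (lrho f) y) (dd e1 (lrho f) y) := by
      rw [phi_eq hΩ hf hp y hy]
      have h20 : rho f y ^ (20:ℝ) = rho f y ^ 20 := by exact_mod_cast Real.rpow_natCast (rho f y) 20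
      have h16 : Real.exp (-16 * lrho f y) = (rho f y ^ 16)⁻¹ := by
        rw [hr, ← Real.exp_nat_mul, ← Real.exp_neg]; congr 1; push_cast; ring
      rw [h20, h16]; field_simp
    rw [h1, ← mul_assoc, ← Real.exp_add, show -m * (k - f y)⁻¹ + -16 * lrho f y
      = -m * (k - f y)⁻¹ - 16 * lrho f y by ring]
    refine mul_le_mul_of_nonneg_left ?_ (Real.exp_pos _).le
    unfold Nfun
    have hQ : 0 ≤ BF (dd e1 (dd e1 f) y) (dd e0 (dd e1 f) y) (dd e0 (dd e0 f) y)
        (dd e0 f y) (dd e1 f y) (dd e0 f y) (dd e1 f y) := by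
      have h2 : 0 ≤ dd e0 (dd e0 f) y * BF (dd e1 (dd e1 f) y) (dd e0 (dd e1 f) y) (dd e0 (dd e0 f) y)
        (dd e0 f y) (dd e1 f y) (dd e0 f y) (dd e1 f y) := by
        have h3 : dd e0 (dd e0 f) y * BF (dd e1 (dd e1 f) y) (dd e0 (dd e1 f) y) (dd e0 (dd e0 f) y)
          (dd e0 f y) (dd e1 f y) (dd e0 f y) (dd e1 f y) = dt f y * dd e0 f y ^ 2 +
            (dd e0 (dd e0 f) y * dd e1 f y - dd e0 (dd e1 f) y * dd e0 f y) ^ 2 := by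
          simp only [BF, dt]; ring
        rw [h3]; positivity
      exact nonneg_of_mul_nonneg_right h2 ha
    have hz : 0 ≤ (k - f y)⁻¹ ^ 4 := by positivity
    have := mul_nonneg (by positivity : 0 ≤ m ^ 2 / 20) (mul_nonneg hz hQ)
    linarith
  have htend : Tendsto (fun k => Real.exp (-m * (k - f y)⁻¹) * (Phi f y / (rho f y) ^ (20:ℝ))) (𝓝[<] C)
      (𝓝 (Real.exp (-m * (C - f y)⁻¹) * (Phi f y / (rho f y) ^ (20:ℝ)))) := by
    have hc : ContinuousAt (fun k => Real.exp (-m * (k - f y)⁻¹) * (Phi f y / (rho f y) ^ (20:ℝ))) C := by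
      have hne : C - f y ≠ 0 := by linarith
      exact ((continuousAt_const.mul ((continuousAt_id.sub continuousAt_const).inv₀ hne)).rexp).mul
        continuousAt_const
    exact hc.tendsto.mono_left nhdsWithin_le_nhds
  have hfin := le_of_tendsto htend (by
    filter_upwards [Ioo_mem_nhdsLT hfy] with k hk using hlow k hk.1 hk.2)
  rw [mul_div_assoc, div_eq_mul_inv (-m)]
  exact hfin

end Fin

/-- Step 1 of the proof of Proposition 3.8: for `f ∈ 𝒮(Ω,C)` solving
PDE (1.2) with `β = 0` and `1/ρ ≤ b` on `Ω`, there exist positive constants `α, N, m`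
and `d₁ > 0` depending only on `α, C, b`, such that `𝒜 ≤ max{d₁, (4/α)𝒟}`. -/
theorem statement18 (C b : ℝ) (hC : 0 < C) (hb : 0 < b) :
    ∃ α N m : ℝ, 0 < α ∧ 0 < N ∧ 0 < m ∧
      ∃ d₁ : ℝ, 0 < d₁ ∧
        ∀ (Ω : Set (Fin 2 → ℝ)) (f : (Fin 2 → ℝ) → ℝ),
          NormalizedDomain Ω → SClass Ω C f → PDE2 f 0 Ω →
          (∀ x ∈ Ω, 1 / rho f x ≤ b) →
          Aval0 Ω C m α f ≤ max d₁ (4 / α * Dval0 Ω C m α N f) := by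
  have hm : 0 < 100000 * C := by positivity
  refine ⟨20, 1, 100000 * C, by norm_num, one_pos, hm, 16000 * b ^ 20 / (100000 * C), by positivity, ?_⟩
  intro Ω f hnd hS hpde hr
  refine le_trans ?_ (le_max_left _ _)
  unfold Aval0
  refine Real.sSup_le ?_ (by positivity)
  rintro _ ⟨y, hy, rfl⟩
  exact main_bound C b _ hb hm (by linarith) hnd hS hpde hr y hy
end

section
/- Let C > 0 and R > 0. Let f be a smooth, strictly convex function on a bounded convex domain Ω ⊂ ℝ² with 0 ∈ Ω, f(0) = 0 = inf_Ω f, f = C on ∂Ω, and Ω ⊆ B_{R/2}(0). Then for every ξ ∈ ℝ² with |ξ| < C/(2R) there exists x ∈ Ω with ∇f(x) = ξ; in particular the Euclidean ball B_{C/(2R)}(0) is contained in the Legendre transform domain Ω* = ∇f(Ω). Moreover, for such ξ the Legendre transform function u of f relative to 0 satisfies −C − R|ξ|/2 ≤ u(ξ) ≤ R|ξ|/2. -/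
open Real Filter Topology Matrix

theorem aux_cs (x y : Fin 2 → ℝ) : |∑ i, x i * y i| ≤ enorm2 x * enorm2 y := by
  unfold enorm2
  rw [← Real.sqrt_mul (by positivity)]
  apply Real.abs_le_sqrt
  simp only [Fin.sum_univ_two]
  nlinarith [sq_nonneg (x 0 * y 1 - x 1 * y 0)]

theorem aux_cont : Continuous enorm2 := by
  unfold enorm2
  fun_prop

/-- Legendre transform domain contains a ball. For a smooth strictly
convex `f` on a bounded convex domain `Ω ⊂ ℝ²` with `0 ∈ Ω`, `f(0) = 0 = inf f`,
`f = C` on `∂Ω` and `Ω ⊆ B_{R/2}(0)`, every `ξ` with `|ξ| < C/(2R)` is attained as a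
gradient `∇f(x)`, `x ∈ Ω` (so `B_{C/(2R)}(0) ⊆ Ω* = ∇f(Ω)`), and the Legendre transform
`u` of `f` relative to `0` satisfies `-C - R|ξ|/2 ≤ u(ξ) ≤ R|ξ|/2` for such `ξ`. -/
theorem statement19 (C R : ℝ) (hC : 0 < C) (hR : 0 < R)
    (Ω : Set (Fin 2 → ℝ)) (hΩo : IsOpen Ω) (hΩc : Convex ℝ Ω)
    (hΩb : Bornology.IsBounded Ω) (h0 : (0 : Fin 2 → ℝ) ∈ Ω)
    (f : (Fin 2 → ℝ) → ℝ) (hsmooth : ContDiffOn ℝ (⊤ : ℕ∞) f Ω)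
    (hconv : ∀ x ∈ Ω, (hess f x).PosDef)
    (hf0 : f 0 = 0) (hinf : sInf (f '' Ω) = 0)
    (hcont : ContinuousOn f (closure Ω)) (hbdry : ∀ x ∈ frontier Ω, f x = C)
    (hsub : ∀ x ∈ Ω, enorm2 x ≤ R / 2)
    (u : (Fin 2 → ℝ) → ℝ) (hu : LegendreOf Ω f u) :
    ∀ ξ : Fin 2 → ℝ, enorm2 ξ < C / (2 * R) →
      (∃ x ∈ Ω, gradv f x = ξ) ∧
      -C - R * enorm2 ξ / 2 ≤ u ξ ∧ u ξ ≤ R * enorm2 ξ / 2 := by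
  intro ξ hξ
  have hcl : IsCompact (closure Ω) := hΩb.isCompact_closure
  have hnn : ∀ x ∈ Ω, 0 ≤ f x := by
    intro x hx
    rw [← hinf]
    exact csInf_le ((hcl.bddBelow_image hcont).mono (Set.image_mono subset_closure))
      (Set.mem_image_of_mem f hx)
  have hsub' : ∀ x ∈ closure Ω, enorm2 x ≤ R / 2 := fun x hx =>
    closure_minimal (t := {x | enorm2 x ≤ R / 2}) hsub
      (isClosed_le aux_cont continuous_const) hx
  have hE : 0 ≤ enorm2 ξ := Real.sqrt_nonneg _
  have hb : ∀ x ∈ closure Ω, |∑ i, x i * ξ i| ≤ R * enorm2 ξ / 2 := by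
    intro x hx
    have h1 := aux_cs x ξ
    have h2 := mul_le_mul_of_nonneg_right (hsub' x hx) hE
    linarith
  have hξR : R * enorm2 ξ < C / 2 := by
    rw [lt_div_iff₀ (by positivity)] at hξ
    linarith
  have hlin : Continuous fun x : Fin 2 → ℝ => ∑ i, x i * ξ i := by fun_prop
  obtain ⟨x, hxc, hmin⟩ := hcl.exists_isMinOn ⟨0, subset_closure h0⟩
    (hcont.sub hlin.continuousOn)
  have hx0 : f x - ∑ i, x i * ξ i ≤ 0 := by
    have := hmin (subset_closure h0)
    simpa [hf0] using this
  have hbx := abs_le.1 (hb x hxc)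
  have hxΩ : x ∈ Ω := by
    by_contra hn
    have hfr : x ∈ frontier Ω := by
      rw [hΩo.frontier_eq]
      exact ⟨hxc, hn⟩
    have := hbdry x hfr
    linarith [hbx.2]
  have hloc : IsLocalMin (fun y => f y - ∑ i, y i * ξ i) x :=
    (hmin.on_subset subset_closure).isLocalMin (hΩo.mem_nhds hxΩ)
  have hdf : DifferentiableAt ℝ f x :=
    (hsmooth.differentiableOn (by simp)).differentiableAt (hΩo.mem_nhds hxΩ)
  let L : (Fin 2 → ℝ) →L[ℝ] ℝ :=
    ∑ i, (ξ i) • (ContinuousLinearMap.proj (R := ℝ) (φ := fun _ : Fin 2 => ℝ) i)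
  have hLa : ∀ y, L y = ∑ i, y i * ξ i := by
    intro y
    simp [L, mul_comm]
  have hd : HasFDerivAt (fun y => f y - ∑ i, y i * ξ i) (fderiv ℝ f x - L) x := by
    have := hdf.hasFDerivAt.sub L.hasFDerivAt
    refine this.congr_of_eventuallyEq (Eventually.of_forall fun y => ?_)
    simp [hLa]
  have hz := hloc.hasFDerivAt_eq_zero hd
  have hg : gradv f x = ξ := by
    funext i
    have h3 : fderiv ℝ f x = L := sub_eq_zero.1 hz
    simp only [gradv, pd, h3, hLa]
    simp [Pi.single_apply]
  have hux := hu x hxΩ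
  rw [hg] at hux
  have hRE : 0 ≤ R * enorm2 ξ := by positivity
  refine ⟨⟨x, hxΩ, hg⟩, ?_, ?_⟩
  · linarith
  · linarith [hnn x hxΩ, hbx.2]
end
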